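/- arXiv:1910.04320 — 4 statements merged into one kernel-verified Lean document; each statement's English description precedes it below -/
import Mathlib

section
/- Fix an integer k ≥ 2 and let n range over multiples of k. Let y_n ∈ Θ_A be the true color assignment and U_n = P(y_n) + σ_n W_c the observation, where W_c is a standard GUE matrix. If there is a constant δ > 0 such that σ_n² > (1+δ)·n·(1−cos(2π/k))/(2 log n) for all n, then the probability that every minimizer of ‖U_n − P(x)‖_F² over x ∈ Θ_A is equivalent to y_n tends to 0 as n → ∞. -/
open MeasureTheory ProbabilityTheory Filter Finset

/-- Law of the independent real coordinates parametrizing a standard GUE matrix: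
the diagonal entries (at `(i,i)`) are `N(0,1)`, and for `i ≠ j` the coordinate at `(i,j)`
is `N(0,1/2)`; for `i < j` the coordinates at `(i,j)` and `(j,i)` serve as the real and
imaginary parts of the `(i,j)` entry of the GUE matrix. -/
noncomputable def gueParamMeasure (n : ℕ) : Measure (Fin n → Fin n → ℝ) :=
  Measure.pi fun i : Fin n => Measure.pi fun j : Fin n =>
    gaussianReal 0 (if i = j then 1 else 1 / 2)

/-- The Hermitian (GUE) matrix built from the real parameters `A`. -/
noncomputable def gueOfParam {n : ℕ} (A : Fin n → Fin n → ℝ) : Fin n → Fin n → ℂ :=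
  fun i j =>
    if i = j then (A i i : ℂ)
    else if (i : ℕ) < (j : ℕ) then (A i j : ℂ) + (A j i : ℂ) * Complex.I
    else (A j i : ℂ) - (A i j : ℂ) * Complex.I

/-- The `m`-th of the `k`-th roots of unity, `e^{2πi m/k}`. -/
noncomputable def rootUnity (k : ℕ) (m : Fin k) : ℂ :=
  Complex.exp (2 * (Real.pi : ℂ) * Complex.I * ((m : ℕ) : ℂ) / (k : ℂ))

/-- The matrix `P(x)` with entries `P(x)_{ab} = x(a) conj(x(b))`, where the color indices are
interpreted as `k`-th roots of unity. -/
noncomputable def Pmat {n : ℕ} (k : ℕ) (x : Fin n → Fin k) : Fin n → Fin n → ℂ :=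
  fun a b => rootUnity k (x a) * (starRingEnd ℂ) (rootUnity k (x b))

/-- The squared Frobenius norm of a complex `n × n` matrix. -/
noncomputable def frobSqC {n : ℕ} (A : Fin n → Fin n → ℂ) : ℝ :=
  ∑ i, ∑ j, Complex.normSq (A i j)

/-- The number of vertices to which `x` assigns color `i`. -/
def colorCard {n k : ℕ} (x : Fin n → Fin k) (i : Fin k) : ℕ :=
  (Finset.univ.filter fun v => x v = i).card

instance (n : ℕ) : IsProbabilityMeasure (gueParamMeasure n) := by
  unfold gueParamMeasure; infer_instance

theorem iIndepFun_gueParam (n : ℕ) :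
    iIndepFun (fun (p : Fin n × Fin n) (A : Fin n → Fin n → ℝ) => A p.1 p.2)
      (gueParamMeasure n) := by
  have h := iIndepFun_uncurry_infinitePi'
    (fun i j : Fin n => gaussianReal 0 (if i = j then 1 else 1 / 2))
    (X := fun _ _ (x : ℝ) => x) (fun _ _ => measurable_id)
  simp only [Measure.infinitePi_eq_pi] at h
  exact h

theorem measurable_gueParam {n : ℕ} (p : Fin n × Fin n) :
    Measurable fun A : Fin n → Fin n → ℝ => A p.1 p.2 :=
  (measurable_pi_apply p.2).comp (measurable_pi_apply p.1)

theorem hasLaw_gueParam {n : ℕ} (p : Fin n × Fin n) :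
    HasLaw (fun A : Fin n → Fin n → ℝ => A p.1 p.2)
      (gaussianReal 0 (if p.1 = p.2 then 1 else 1 / 2)) (gueParamMeasure n) where
  aemeasurable := (measurable_gueParam p).aemeasurable
  map_eq := by
    have h1 := measurePreserving_eval (fun i : Fin n => Measure.pi fun j : Fin n =>
      gaussianReal 0 (if i = j then 1 else 1 / 2)) p.1
    have h2 := measurePreserving_eval (fun j : Fin n =>
      gaussianReal 0 (if p.1 = j then 1 else 1 / 2)) p.2
    exact (h2.comp h1).map_eq

theorem hasGaussianLaw_gueParam (n : ℕ) :
    HasGaussianLaw (fun (A : Fin n → Fin n → ℝ) (p : Fin n × Fin n) => A p.1 p.2)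
      (gueParamMeasure n) :=
  (iIndepFun_gueParam n).hasGaussianLaw fun p => (hasLaw_gueParam p).hasGaussianLaw

/-- The real linear functional with coefficients `c` on the GUE parameters. -/
def paramLin {n : ℕ} (c : Fin n × Fin n → ℝ) (A : Fin n → Fin n → ℝ) : ℝ :=
  ∑ p, c p * A p.1 p.2

theorem measurable_paramLin {n : ℕ} (c : Fin n × Fin n → ℝ) : Measurable (paramLin c) := by
  unfold paramLin; fun_prop

theorem hasGaussianLaw_paramLin_family {n : ℕ} {ι : Type*} [Finite ι]
    (c : ι → Fin n × Fin n → ℝ) :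
    HasGaussianLaw (fun A i => paramLin (c i) A) (gueParamMeasure n) := by
  have := Fintype.ofFinite ι
  have h := (hasGaussianLaw_gueParam n).map_fun
    (ContinuousLinearMap.pi fun i : ι =>
      ∑ p, c i p • ContinuousLinearMap.proj (R := ℝ) (φ := fun _ : Fin n × Fin n => ℝ) p)
  convert! h using 3
  simp [paramLin]

theorem memLp_gueParam {n : ℕ} (p : Fin n × Fin n) :
    MemLp (fun A : Fin n → Fin n → ℝ => A p.1 p.2) 2 (gueParamMeasure n) :=
  (hasLaw_gueParam p).hasGaussianLaw.memLp_two

theorem integral_paramLin {n : ℕ} (c : Fin n × Fin n → ℝ) :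
    ∫ A, paramLin c A ∂gueParamMeasure n = 0 := by
  unfold paramLin
  rw [integral_finsetSum _ fun p _ => ((memLp_gueParam p).integrable (by norm_num)).const_mul _]
  refine Finset.sum_eq_zero fun p _ => ?_
  rw [integral_const_mul, (hasLaw_gueParam p).integral_eq]
  simp

theorem covariance_paramLin {n : ℕ} (c d : Fin n × Fin n → ℝ) :
    cov[paramLin c, paramLin d; gueParamMeasure n] =
      ∑ p, c p * d p * (if p.1 = p.2 then 1 else 1 / 2) := by
  unfold paramLin
  rw [covariance_fun_sum_fun_sum (fun p => (memLp_gueParam p).const_mul _)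
    (fun p => (memLp_gueParam p).const_mul _)]
  refine Finset.sum_congr rfl fun p _ => ?_
  rw [Finset.sum_eq_single p]
  · rw [covariance_const_mul_left, covariance_const_mul_right,
      covariance_self (measurable_gueParam p).aemeasurable, (hasLaw_gueParam p).variance_eq,
      variance_id_gaussianReal]
    split_ifs
    · simp
    · simp; ring
  · intro q _ hq
    rw [covariance_const_mul_left, covariance_const_mul_right,
      ((iIndepFun_gueParam n).indepFun hq.symm).covariance_eq_zero (memLp_gueParam p)
        (memLp_gueParam q)]
    simp
  · simp

theorem map_paramLin {n : ℕ} (c : Fin n × Fin n → ℝ) :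
    (gueParamMeasure n).map (paramLin c) = gaussianReal 0
      (∑ p, c p * c p * (if p.1 = p.2 then 1 else 1 / 2)).toNNReal := by
  have h : HasGaussianLaw (paramLin c) (gueParamMeasure n) :=
    (hasGaussianLaw_paramLin_family (fun _ : Unit => c)).eval ()
  rw [h.map_eq_gaussianReal, integral_paramLin,
    ← covariance_self (measurable_paramLin c).aemeasurable, covariance_paramLin]

theorem iIndepFun_paramLin {n : ℕ} {ι : Type*} [Finite ι] (c : ι → Fin n × Fin n → ℝ)
    (h : ∀ i j, i ≠ j → ∑ p, c i p * c j p * (if p.1 = p.2 then 1 else 1 / 2) = 0) :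
    iIndepFun (fun i => paramLin (c i)) (gueParamMeasure n) :=
  (hasGaussianLaw_paramLin_family c).iIndepFun_of_covariance_eq_zero fun i j hij => by
    rw [covariance_paramLin, h i j hij]

theorem indepFun_paramLin {n : ℕ} {ι : Type*} [Finite ι] (c : ι → Fin n × Fin n → ℝ)
    (d : Fin n × Fin n → ℝ)
    (h : ∀ i, ∑ p, c i p * d p * (if p.1 = p.2 then 1 else 1 / 2) = 0) :
    IndepFun (fun A i => paramLin (c i) A) (paramLin d) (gueParamMeasure n) := by
  have := Fintype.ofFinite ι
  have hfam := (hasGaussianLaw_paramLin_family (fun o : Option ι => o.elim d c)).map_fun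
    ((ContinuousLinearMap.pi fun i : ι =>
      ContinuousLinearMap.proj (R := ℝ) (φ := fun _ : Option ι => ℝ) (some i)).prod
     (ContinuousLinearMap.pi fun _ : Unit =>
      ContinuousLinearMap.proj (R := ℝ) (φ := fun _ : Option ι => ℝ) none))
  have key := HasGaussianLaw.indepFun_of_covariance_eval
    (X := fun i => paramLin (c i)) (Y := fun _ : Unit => paramLin d) hfam
    fun i _ => by rw [covariance_paramLin, h i]
  exact key.comp (φ := id) (ψ := fun f : Unit → ℝ => f ()) measurable_id
    (measurable_pi_apply ())

/-- A selection bound: indices `a ∈ S` and `b ∈ T` with `G a, G b > τ` are chosen as a function of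
`G` alone, so the remainder `R a b` at the selected pair keeps its own lower tail. -/
theorem measure_forall_add_le {Ω ι : Type*} [MeasurableSpace Ω] [Fintype ι]
    {μ : Measure Ω} [IsProbabilityMeasure μ] {G : ι → Ω → ℝ} {R : ι → ι → Ω → ℝ}
    {S T : Finset ι} {τ ρ : ℝ} {P q : ENNReal}
    (hGm : ∀ i, Measurable (G i)) (hG : iIndepFun G μ)
    (hind : ∀ a ∈ S, ∀ b ∈ T, IndepFun (fun ω i => G i ω) (R a b) μ)
    (hS : ∀ a ∈ S, μ {ω | G a ω ≤ τ} ≤ P) (hT : ∀ b ∈ T, μ {ω | G b ω ≤ τ} ≤ P)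
    (hR : ∀ a ∈ S, ∀ b ∈ T, μ {ω | R a b ω ≤ -ρ} ≤ q) :
    μ {ω | ∀ a ∈ S, ∀ b ∈ T, G a ω + G b ω + R a b ω ≤ 2 * τ - ρ} ≤
      P ^ S.card + P ^ T.card + q := by
  classical
  have hblock : ∀ V : Finset ι, (∀ a ∈ V, μ {ω | G a ω ≤ τ} ≤ P) →
      μ {ω | ∀ a ∈ V, G a ω ≤ τ} ≤ P ^ V.card := by
    intro V hV
    have hset : {ω | ∀ a ∈ V, G a ω ≤ τ} = ⋂ a ∈ V, G a ⁻¹' Set.Iic τ := by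
      ext; simp
    rw [hset, hG.measure_inter_preimage_eq_mul V fun _ _ => measurableSet_Iic]
    exact Finset.prod_le_pow_card _ _ _ hV
  let pat : (ι → ℝ) → Finset ι := fun g => univ.filter fun i => τ < g i
  have hpatm : ∀ Q : Finset ι, MeasurableSet (pat ⁻¹' {Q}) := by
    intro Q
    have : pat ⁻¹' {Q} = ⋂ i, {g : ι → ℝ | τ < g i ↔ i ∈ Q} := by
      ext g; simp [pat, Finset.ext_iff]
    rw [this]
    refine MeasurableSet.iInter fun i => ?_
    by_cases hi : i ∈ Q
    · simpa [hi] using measurableSet_lt measurable_const (measurable_pi_apply i)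
    · simpa [hi] using measurableSet_le (measurable_pi_apply i) measurable_const
  have hGv : Measurable fun ω i => G i ω := measurable_pi_lambda _ hGm
  let C : Finset ι → Set Ω := fun Q => (fun ω i => G i ω) ⁻¹' (pat ⁻¹' {Q})
  have hCm : ∀ Q, MeasurableSet (C Q) := fun Q => hGv (hpatm Q)
  let bad : Set Ω := {ω | ∀ a ∈ S, ∀ b ∈ T, G a ω + G b ω + R a b ω ≤ 2 * τ - ρ}
  have hC : ∀ Q, (∃ a ∈ S, a ∈ Q) → (∃ b ∈ T, b ∈ Q) → μ (C Q ∩ bad) ≤ μ (C Q) * q := by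
    rintro Q ⟨a, haS, haQ⟩ ⟨b, hbT, hbQ⟩
    calc μ (C Q ∩ bad) ≤ μ (C Q ∩ R a b ⁻¹' Set.Iic (-ρ)) := by
          refine measure_mono fun ω hω => ⟨hω.1, ?_⟩
          have hQ : pat (fun i => G i ω) = Q := hω.1
          rw [← hQ] at haQ hbQ
          have h1 : τ < G a ω := by simpa [pat] using haQ
          have h2 : τ < G b ω := by simpa [pat] using hbQ
          have h3 := hω.2 a haS b hbT
          change R a b ω ≤ -ρ
          linarith
      _ = μ (C Q) * μ (R a b ⁻¹' Set.Iic (-ρ)) :=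
          (hind a haS b hbT).measure_inter_preimage_eq_mul _ _ (hpatm Q) measurableSet_Iic
      _ ≤ μ (C Q) * q := by gcongr; exact hR a haS b hbT
  let 𝒬 : Finset (Finset ι) := univ.filter fun Q => (∃ a ∈ S, a ∈ Q) ∧ ∃ b ∈ T, b ∈ Q
  have hcover : bad ⊆ ({ω | ∀ a ∈ S, G a ω ≤ τ} ∪ {ω | ∀ b ∈ T, G b ω ≤ τ}) ∪
      ⋃ Q ∈ 𝒬, C Q ∩ bad := by
    intro ω hω
    by_cases h1 : ∀ a ∈ S, G a ω ≤ τ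
    · exact Or.inl (Or.inl h1)
    by_cases h2 : ∀ b ∈ T, G b ω ≤ τ
    · exact Or.inl (Or.inr h2)
    push Not at h1 h2
    refine Or.inr (Set.mem_biUnion (x := pat fun i => G i ω) ?_ ⟨rfl, hω⟩)
    simpa [𝒬, pat] using ⟨h1, h2⟩
  have hdisj : Set.PairwiseDisjoint (↑𝒬) C := by
    intro Q _ Q' _ hne
    refine Set.disjoint_left.2 fun ω h h' => hne ?_
    exact (show pat _ = Q from h).symm.trans h'
  calc μ bad ≤ _ := measure_mono hcover
    _ ≤ (μ {ω | ∀ a ∈ S, G a ω ≤ τ} + μ {ω | ∀ b ∈ T, G b ω ≤ τ}) +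
        μ (⋃ Q ∈ 𝒬, C Q ∩ bad) :=
        (measure_union_le _ _).trans (by gcongr; exact measure_union_le _ _)
    _ ≤ P ^ S.card + P ^ T.card + q := by
        gcongr
        · exact hblock S hS
        · exact hblock T hT
        calc μ (⋃ Q ∈ 𝒬, C Q ∩ bad) ≤ ∑ Q ∈ 𝒬, μ (C Q ∩ bad) := measure_biUnion_finset_le _ _
          _ ≤ ∑ Q ∈ 𝒬, μ (C Q) * q := by
              refine Finset.sum_le_sum fun Q hQ => ?_
              obtain ⟨h1, h2⟩ := (Finset.mem_filter.1 hQ).2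
              exact hC Q h1 h2
          _ = μ (⋃ Q ∈ 𝒬, C Q) * q := by
              rw [← Finset.sum_mul, measure_biUnion_finset hdisj fun Q _ => hCm Q]
          _ ≤ 1 * q := by gcongr; exact prob_le_one
          _ = q := one_mul q

/-- A lower bound on the Gaussian upper tail, as an upper bound on the distribution function. -/
theorem gaussianReal_Iic_le {V : NNReal} (hV : V ≠ 0) {u : ℝ} (hu : 0 ≤ u) :
    gaussianReal 0 V (Set.Iic (u * √V)) ≤
      ENNReal.ofReal (1 - Real.exp (-(u + 1) ^ 2 / 2) / √(2 * Real.pi)) := by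
  have hVpos : (0 : ℝ) < V := by positivity
  have hs : 0 < √(V : ℝ) := Real.sqrt_pos.2 hVpos
  set c : ℝ := Real.exp (-(u + 1) ^ 2 / 2) / √(2 * Real.pi) with hc
  have hc0 : 0 ≤ c := by positivity
  have htail : ENNReal.ofReal c ≤ gaussianReal 0 V (Set.Ioc (u * √V) ((u + 1) * √V)) := by
    rw [gaussianReal_apply _ hV]
    calc ENNReal.ofReal c
        = ENNReal.ofReal (c / √V) * volume (Set.Ioc (u * √(V : ℝ)) ((u + 1) * √V)) := by
          rw [Real.volume_Ioc, ← ENNReal.ofReal_mul (by positivity)]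
          congr 1; field_simp; ring
      _ = ∫⁻ _ in Set.Ioc (u * √(V : ℝ)) ((u + 1) * √V), ENNReal.ofReal (c / √V) := by
          rw [setLIntegral_const]
      _ ≤ _ := by
          refine setLIntegral_mono (measurable_gaussianPDF _ _) fun x hx => ?_
          refine ENNReal.ofReal_le_ofReal ?_
          have hcV : c / √V = (√(2 * Real.pi * V))⁻¹ * Real.exp (-(u + 1) ^ 2 / 2) := by
            rw [hc, Real.sqrt_mul (by positivity) (V : ℝ), mul_inv]
            ring
          rw [gaussianPDFReal, hcV]
          refine mul_le_mul_of_nonneg_left (Real.exp_le_exp.2 ?_) (by positivity)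
          have hx0 : 0 ≤ x := le_trans (by positivity) hx.1.le
          have : (x - 0) ^ 2 ≤ (u + 1) ^ 2 * V := by
            have h := pow_le_pow_left₀ hx0 hx.2 2
            rwa [mul_pow, Real.sq_sqrt hVpos.le, ← sub_zero x] at h
          rw [div_le_div_iff₀ (by norm_num) (by positivity)]
          nlinarith
  have hle : gaussianReal 0 V (Set.Iic (u * √V)) +
      gaussianReal 0 V (Set.Ioc (u * √V) ((u + 1) * √V)) ≤ 1 := by
    rw [← measure_union (Set.Iic_disjoint_Ioc le_rfl) measurableSet_Ioc]
    exact prob_le_one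
  rw [ENNReal.ofReal_sub _ hc0, ENNReal.ofReal_one]
  refine ENNReal.le_sub_of_add_le_right ENNReal.ofReal_ne_top ?_
  exact (add_le_add_right htail _).trans hle

theorem measure_gaussian_le_neg {Ω : Type*} [MeasurableSpace Ω] {μ : Measure Ω}
    {X : Ω → ℝ} (hX : Measurable X) {V : NNReal} (hlaw : μ.map X = gaussianReal 0 V)
    {ρ : ℝ} (hρ : 0 < ρ) : μ {ω | X ω ≤ -ρ} ≤ ENNReal.ofReal (V / ρ ^ 2) := by
  have h1 : μ {ω | X ω ≤ -ρ} = gaussianReal 0 V (Set.Iic (-ρ)) := by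
    rw [← hlaw, Measure.map_apply hX measurableSet_Iic]; rfl
  have h2 := meas_ge_le_variance_div_sq (μ := gaussianReal 0 V) (memLp_id_gaussianReal 2) hρ
  rw [variance_id_gaussianReal] at h2
  rw [h1]
  refine (measure_mono fun x hx => ?_).trans h2
  have hx : x ≤ -ρ := hx
  simp only [id_eq, integral_id_gaussianReal, Set.mem_ofPred_eq, sub_zero]
  exact (by linarith : ρ ≤ -x).trans (neg_le_abs x)

theorem sum_sum_eq_of_add_swap_eq {n : ℕ} {u v : Fin n → Fin n → ℝ}
    (h : ∀ i j, u i j + u j i = v i j + v j i) : ∑ i, ∑ j, u i j = ∑ i, ∑ j, v i j := by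
  have hu : ∑ i, ∑ j, u j i = ∑ i, ∑ j, u i j := Finset.sum_comm
  have hv : ∑ i, ∑ j, v j i = ∑ i, ∑ j, v i j := Finset.sum_comm
  have key : ∑ i, ∑ j, (u i j + u j i) = ∑ i, ∑ j, (v i j + v j i) := by simp_rw [h]
  simp only [Finset.sum_add_distrib] at key
  linarith

/-- The coefficients, on the GUE parameters, of the functional `W ↦ Re ⟨W, C⟩`. -/
def hermCoef {n : ℕ} (C : Fin n → Fin n → ℂ) (p : Fin n × Fin n) : ℝ :=
  if p.1 = p.2 then (C p.1 p.1).re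
  else if (p.1 : ℕ) < (p.2 : ℕ) then 2 * (C p.1 p.2).re else 2 * (C p.2 p.1).im

theorem paramLin_hermCoef {n : ℕ} {C : Fin n → Fin n → ℂ}
    (hC : ∀ i j, C j i = (starRingEnd ℂ) (C i j)) (A : Fin n → Fin n → ℝ) :
    paramLin (hermCoef C) A = ∑ i, ∑ j, (gueOfParam A i j * (starRingEnd ℂ) (C i j)).re := by
  rw [paramLin, Fintype.sum_prod_type]
  refine sum_sum_eq_of_add_swap_eq fun i j => ?_
  rcases lt_trichotomy (i : ℕ) (j : ℕ) with hij | hij | hij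
  · have hne : i ≠ j := fun h => by simp [h] at hij
    rw [hC i j]
    simp [hermCoef, gueOfParam, hne, hne.symm, hij, hij.not_gt]
    ring
  · have h : i = j := Fin.ext hij
    subst h
    simp [hermCoef, gueOfParam]
    ring
  · have hne : j ≠ i := fun h => by simp [h] at hij
    rw [hC j i]
    simp [hermCoef, gueOfParam, hne, hne.symm, hij, hij.not_gt]
    ring

theorem sum_hermCoef_mul {n : ℕ} {C D : Fin n → Fin n → ℂ}
    (hC : ∀ i j, C j i = (starRingEnd ℂ) (C i j)) (hD : ∀ i j, D j i = (starRingEnd ℂ) (D i j)) :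
    ∑ p : Fin n × Fin n, hermCoef C p * hermCoef D p * (if p.1 = p.2 then 1 else 1 / 2) =
      ∑ i, ∑ j, (C i j * (starRingEnd ℂ) (D i j)).re := by
  rw [Fintype.sum_prod_type]
  refine sum_sum_eq_of_add_swap_eq fun i j => ?_
  rcases lt_trichotomy (i : ℕ) (j : ℕ) with hij | hij | hij
  · have hne : i ≠ j := fun h => by simp [h] at hij
    rw [hC i j, hD i j]
    simp [hermCoef, hne, hne.symm, hij, hij.not_gt]
    ring
  · have h : i = j := Fin.ext hij
    subst h
    have h1 : (C i i).im = 0 := by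
      have := congrArg Complex.im (hC i i); simp at this; linarith
    simp [hermCoef, h1]
  · have hne : j ≠ i := fun h => by simp [h] at hij
    rw [hC j i, hD j i]
    simp [hermCoef, hne, hne.symm, hij, hij.not_gt]
    ring

/-- The part of the perturbation `d` of the rank-one matrix `y y*` at a vertex `a ∈ S` that lies in
the columns (and rows) outside `S`. -/
def crossPart {n : ℕ} (S : Finset (Fin n)) (y d : Fin n → ℂ) (a : Fin n) :
    Fin n → Fin n → ℂ := fun i j =>
  if a ∈ S ∧ i = a ∧ j ∉ S then d a * (starRingEnd ℂ) (y j)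
  else if a ∈ S ∧ j = a ∧ i ∉ S then y i * (starRingEnd ℂ) (d a) else 0

/-- The difference of two rank-one matrices. -/
def outerDiff {n : ℕ} (z y : Fin n → ℂ) : Fin n → Fin n → ℂ := fun i j =>
  z i * (starRingEnd ℂ) (z j) - y i * (starRingEnd ℂ) (y j)

/-- The block-diagonal part of a matrix for the partition into `S` and its complement. -/
def blockPart {n : ℕ} (S : Finset (Fin n)) (C : Fin n → Fin n → ℂ) : Fin n → Fin n → ℂ :=
  fun i j => if i ∈ S ↔ j ∈ S then C i j else 0

theorem crossPart_swap {n : ℕ} (S : Finset (Fin n)) (y d : Fin n → ℂ) (a i j : Fin n) :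
    crossPart S y d a j i = (starRingEnd ℂ) (crossPart S y d a i j) := by
  unfold crossPart
  by_cases h1 : a ∈ S ∧ i = a ∧ j ∉ S
  · have h2 : ¬ (a ∈ S ∧ j = a ∧ i ∉ S) := by
      rintro ⟨h, rfl, -⟩; exact h1.2.2 h
    rw [if_pos h1, if_neg h2, if_pos h1]
    simp [mul_comm]
  · by_cases h2 : a ∈ S ∧ j = a ∧ i ∉ S
    · rw [if_pos h2, if_neg h1, if_pos h2]
      simp [mul_comm]
    · simp only [h1, h2, if_false]
      simp

theorem outerDiff_swap {n : ℕ} (z y : Fin n → ℂ) (i j : Fin n) :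
    outerDiff z y j i = (starRingEnd ℂ) (outerDiff z y i j) := by
  simp [outerDiff, mul_comm]

theorem blockPart_swap {n : ℕ} (S : Finset (Fin n)) {C : Fin n → Fin n → ℂ}
    (hC : ∀ i j, C j i = (starRingEnd ℂ) (C i j)) (i j : Fin n) :
    blockPart S C j i = (starRingEnd ℂ) (blockPart S C i j) := by
  unfold blockPart
  by_cases h : i ∈ S ↔ j ∈ S
  · rw [if_pos h, if_pos h.symm, hC]
  · rw [if_neg h, if_neg fun h' => h h'.symm, map_zero]

theorem crossPart_mul_crossPart {n : ℕ} (S : Finset (Fin n)) (y d : Fin n → ℂ) {a b : Fin n}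
    (hab : a ≠ b) (i j : Fin n) :
    crossPart S y d a i j * (starRingEnd ℂ) (crossPart S y d b i j) = 0 := by
  unfold crossPart
  split_ifs <;> simp <;> grind

theorem crossPart_mul_blockPart {n : ℕ} (S : Finset (Fin n)) (y d : Fin n → ℂ)
    (C : Fin n → Fin n → ℂ) (a i j : Fin n) :
    crossPart S y d a i j * (starRingEnd ℂ) (blockPart S C i j) = 0 := by
  unfold crossPart blockPart
  split_ifs <;> simp <;> grind

theorem outerDiff_eq_add {n : ℕ} {S : Finset (Fin n)} {y d z : Fin n → ℂ} {a b : Fin n}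
    (ha : a ∈ S) (hb : b ∈ S) (hab : a ≠ b) (hz : ∀ i, i ≠ a → i ≠ b → z i = y i)
    (hza : z a = y a + d a) (hzb : z b = y b + d b) (i j : Fin n) :
    outerDiff z y i j = crossPart S y d a i j + crossPart S y d b i j +
      blockPart S (outerDiff z y) i j := by
  have key : ∀ i j, i ∈ S → j ∉ S →
      outerDiff z y i j = crossPart S y d a i j + crossPart S y d b i j := by
    intro i j hi hj
    have hja : j ≠ a := fun h => hj (h ▸ ha)
    have hjb : j ≠ b := fun h => hj (h ▸ hb)
    unfold outerDiff crossPart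
    rw [hz j hja hjb]
    by_cases hia : i = a
    · subst hia
      simp [ha, hj, hab, hjb, hza]; ring
    · by_cases hib : i = b
      · subst hib
        simp [hb, hj, hab.symm, hja, hzb]; ring
      · simp [hia, hib, hja, hjb, hz i hia hib]
  have hzero : ∀ c i j, (i ∈ S ↔ j ∈ S) → crossPart S y d c i j = 0 := by
    intro c i j h
    unfold crossPart
    split_ifs <;> grind
  by_cases hij : i ∈ S ↔ j ∈ S
  · rw [hzero a i j hij, hzero b i j hij, blockPart, if_pos hij]; ring
  · rw [blockPart, if_neg hij, add_zero]
    by_cases hi : i ∈ S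
    · exact key i j hi fun hj => hij ⟨fun _ => hj, fun _ => hi⟩
    · have hj : j ∈ S := by by_contra hj; exact hij ⟨fun h => (hi h).elim, fun h => (hj h).elim⟩
      rw [outerDiff_swap z y j i, crossPart_swap S y d a j i, crossPart_swap S y d b j i,
        key j i hj hi, map_add]

theorem sum_normSq_crossPart {n : ℕ} {S : Finset (Fin n)} {y d : Fin n → ℂ}
    (hy : ∀ i, Complex.normSq (y i) = 1) {a : Fin n} (ha : a ∈ S) :
    ∑ i, ∑ j, Complex.normSq (crossPart S y d a i j) =
      2 * (n - S.card) * Complex.normSq (d a) := by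
  have h : ∀ i j, Complex.normSq (crossPart S y d a i j) =
      (if i = a then (if j ∈ Sᶜ then Complex.normSq (d a) else 0) else 0) +
      (if j = a then (if i ∈ Sᶜ then Complex.normSq (d a) else 0) else 0) := by
    intro i j
    unfold crossPart
    by_cases h1 : i = a <;> by_cases h2 : j = a <;> by_cases h3 : i ∈ S <;>
      by_cases h4 : j ∈ S <;> simp_all [Complex.normSq_mul, Complex.normSq_conj]
  simp_rw [h, Finset.sum_add_distrib, Finset.sum_ite_eq', Finset.mem_univ, if_true]
  rw [Finset.sum_comm]
  simp_rw [Finset.sum_ite_eq', Finset.mem_univ, if_true]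
  rw [Finset.sum_ite_mem, Finset.univ_inter, Finset.sum_const, Finset.card_compl,
    Fintype.card_fin, nsmul_eq_mul, Nat.cast_sub (by simpa using S.card_le_univ)]
  ring

theorem sum_normSq_outerDiff {n : ℕ} {z y : Fin n → ℂ} (hz : ∀ i, Complex.normSq (z i) = 1)
    (hy : ∀ i, Complex.normSq (y i) = 1) :
    ∑ i, ∑ j, Complex.normSq (outerDiff z y i j) =
      2 * (n : ℝ) ^ 2 - 2 * Complex.normSq (∑ i, z i * (starRingEnd ℂ) (y i)) := by
  have h : ∀ i j, Complex.normSq (outerDiff z y i j) =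
      2 - 2 * ((z i * (starRingEnd ℂ) (y i)) *
        (starRingEnd ℂ) (z j * (starRingEnd ℂ) (y j))).re := by
    intro i j
    rw [outerDiff, Complex.normSq_sub]
    simp only [Complex.normSq_conj, hz, hy, map_mul, Complex.conj_conj]
    rw [show z i * (starRingEnd ℂ) (z j) * ((starRingEnd ℂ) (y i) * y j) =
      z i * (starRingEnd ℂ) (y i) * ((starRingEnd ℂ) (z j) * y j) by ring]
    norm_num
  have h2 : Complex.normSq (∑ i, z i * (starRingEnd ℂ) (y i)) =
      ∑ i, ∑ j, ((z i * (starRingEnd ℂ) (y i)) *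
        (starRingEnd ℂ) (z j * (starRingEnd ℂ) (y j))).re := by
    rw [← Complex.ofReal_re (Complex.normSq _), ← Complex.mul_conj, map_sum, Finset.sum_mul_sum]
    simp_rw [Complex.re_sum]
  rw [h2]
  simp_rw [h, Finset.sum_sub_distrib, ← Finset.mul_sum]
  simp; ring

theorem sum_normSq_outerDiff_swap_le {n : ℕ} {z y : Fin n → ℂ} {w : ℂ} {a b : Fin n}
    (hab : a ≠ b) (hw : Complex.normSq w = 1)
    (hy : ∀ i, Complex.normSq (y i) = 1) (hz : ∀ i, i ≠ a → i ≠ b → z i = y i)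
    (hya : y a = 1) (hza : z a = w) (hyb : y b = w) (hzb : z b = 1) :
    ∑ i, ∑ j, Complex.normSq (outerDiff z y i j) ≤ 8 * n * (1 - w.re) := by
  have hz1 : ∀ i, Complex.normSq (z i) = 1 := by
    intro i
    by_cases hia : i = a
    · rw [hia, hza, hw]
    · by_cases hib : i = b
      · rw [hib, hzb, map_one]
      · rw [hz i hia hib, hy]
  have hsum : ∑ i, z i * (starRingEnd ℂ) (y i) = ((n - 2 * (1 - w.re) : ℝ) : ℂ) := by
    have h : ∀ i, z i * (starRingEnd ℂ) (y i) =
        1 + (if i = a then w - 1 else 0) + (if i = b then (starRingEnd ℂ) w - 1 else 0) := by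
      intro i
      by_cases hia : i = a
      · subst hia; simp [hab, hya, hza]
      · by_cases hib : i = b
        · subst hib; simp [hia, hyb, hzb]
        · simp [hia, hib, hz i hia hib, Complex.mul_conj, hy]
    simp_rw [h, Finset.sum_add_distrib]
    have := Complex.add_conj w
    push_cast at this
    simp
    linear_combination this
  rw [sum_normSq_outerDiff hz1 hy, hsum, Complex.normSq_ofReal]
  nlinarith [sq_nonneg (1 - w.re)]

theorem paramLin_const_mul {n : ℕ} (s : ℝ) (c : Fin n × Fin n → ℝ) (A : Fin n → Fin n → ℝ) :
    paramLin (fun p => s * c p) A = s * paramLin c A := by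
  simp only [paramLin, Finset.mul_sum, mul_assoc]

theorem sum_const_mul_hermCoef_mul {n : ℕ} {s : ℝ} (hs : s ^ 2 = 1) {C D : Fin n → Fin n → ℂ}
    (hC : ∀ i j, C j i = (starRingEnd ℂ) (C i j)) (hD : ∀ i j, D j i = (starRingEnd ℂ) (D i j)) :
    ∑ p : Fin n × Fin n, (s * hermCoef C p) * (s * hermCoef D p) *
      (if p.1 = p.2 then 1 else 1 / 2) = ∑ i, ∑ j, (C i j * (starRingEnd ℂ) (D i j)).re := by
  rw [← sum_hermCoef_mul hC hD]
  refine Finset.sum_congr rfl fun p _ => ?_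
  linear_combination (hermCoef C p * hermCoef D p * (if p.1 = p.2 then 1 else 1 / 2)) * hs

theorem map_paramLin_hermCoef {n : ℕ} {s : ℝ} (hs : s ^ 2 = 1) {C : Fin n → Fin n → ℂ}
    (hC : ∀ i j, C j i = (starRingEnd ℂ) (C i j)) :
    (gueParamMeasure n).map (paramLin fun p => s * hermCoef C p) =
      gaussianReal 0 (∑ i, ∑ j, Complex.normSq (C i j)).toNNReal := by
  rw [map_paramLin, sum_const_mul_hermCoef_mul hs hC hC]
  simp_rw [Complex.mul_conj, Complex.ofReal_re]

/-- A bound for the probability that no transposition of a vertex of `S` with one of `T` gains more than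
`2 u √V - ρ`, where `S` and `T` consist of vertices with labels `1` and `w`. -/
theorem measure_forall_swap_le {n : ℕ} {y : Fin n → ℂ} {w : ℂ} {S T : Finset (Fin n)} {r : ℕ}
    {s u ρ V : ℝ} (hw : Complex.normSq w = 1) (hw1 : w ≠ 1)
    (hy : ∀ i, Complex.normSq (y i) = 1)
    (hS : ∀ a ∈ S, y a = 1) (hT : ∀ b ∈ T, y b = w) (hSr : S.card = r) (hTr : T.card = r)
    (hr : 2 * r < n) (hs : s ^ 2 = 1) (hu : 0 ≤ u) (hρ : 0 < ρ)
    (hV : V = 4 * (n - 2 * r) * (1 - w.re)) (z : Fin n → Fin n → Fin n → ℂ)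
    (hz : ∀ a ∈ S, ∀ b ∈ T, (∀ i, i ≠ a → i ≠ b → z a b i = y i) ∧ z a b a = w ∧ z a b b = 1) :
    gueParamMeasure n {A | ∀ a ∈ S, ∀ b ∈ T,
      s * ∑ i, ∑ j, (gueOfParam A i j * (starRingEnd ℂ) (outerDiff (z a b) y i j)).re ≤
        2 * (u * √V) - ρ} ≤
      2 * ENNReal.ofReal (1 - Real.exp (-(u + 1) ^ 2 / 2) / √(2 * Real.pi)) ^ r +
        ENNReal.ofReal (8 * n * (1 - w.re) / ρ ^ 2) := by
  have hwre : w.re < 1 := by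
    by_contra h
    have h1 : w.re * w.re + w.im * w.im = 1 := by rw [← Complex.normSq_apply, hw]
    have h2 : w.re = 1 := by nlinarith [mul_self_nonneg w.im]
    have h3 : w.im = 0 := by
      have : w.im * w.im = 0 := by rw [h2] at h1; linarith
      simpa using this
    exact hw1 (Complex.ext h2 h3)
  have hrR : (2 * r : ℝ) < n := by exact_mod_cast hr
  have hVpos : 0 < V := by
    rw [hV]
    exact mul_pos (mul_pos (by norm_num) (by linarith)) (by linarith)
  have hdisj : Disjoint S T := Finset.disjoint_left.2 fun a ha hb =>
    hw1 ((hT a hb).symm.trans (hS a ha))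
  set U := S ∪ T with hU
  have hUcard : (U.card : ℝ) = 2 * r := by
    rw [hU, Finset.card_union_of_disjoint hdisj, hSr, hTr]; push_cast; ring
  set d : Fin n → ℂ := fun i => if y i = 1 then w - 1 else 1 - w with hd
  have hdS : ∀ a ∈ S, d a = w - 1 := fun a ha => by simp [hd, hS a ha]
  have hdT : ∀ b ∈ T, d b = 1 - w := fun b hb => by simp [hd, hT b hb, hw1]
  have hwsub : Complex.normSq (w - 1) = 2 * (1 - w.re) := by
    rw [Complex.normSq_sub, hw]; simp; ring
  have hdU : ∀ a ∈ U, Complex.normSq (d a) = 2 * (1 - w.re) := by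
    intro a ha
    rcases Finset.mem_union.1 ha with ha | ha
    · rw [hdS a ha, hwsub]
    · rw [hdT a ha, ← hwsub, ← Complex.normSq_neg, neg_sub]
  let G : Fin n → (Fin n → Fin n → ℝ) → ℝ := fun a =>
    paramLin fun p => s * hermCoef (crossPart U y d a) p
  let R : Fin n → Fin n → (Fin n → Fin n → ℝ) → ℝ := fun a b =>
    paramLin fun p => s * hermCoef (blockPart U (outerDiff (z a b) y)) p
  have hblock := fun a b => blockPart_swap U (outerDiff_swap (z a b) y)
  have hcross := crossPart_swap U y d
  have htail : ∀ a ∈ U, gueParamMeasure n {A | G a A ≤ u * √V} ≤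
      ENNReal.ofReal (1 - Real.exp (-(u + 1) ^ 2 / 2) / √(2 * Real.pi)) := by
    intro a ha
    have hlaw := map_paramLin_hermCoef hs (hcross a)
    rw [sum_normSq_crossPart hy ha, hdU a ha, hUcard,
      show 2 * ((n : ℝ) - 2 * r) * (2 * (1 - w.re)) = V by rw [hV]; ring] at hlaw
    have hne : V.toNNReal ≠ 0 := by simpa using hVpos
    have h := gaussianReal_Iic_le hne hu
    rw [← hlaw, Measure.map_apply (measurable_paramLin _) measurableSet_Iic,
      Real.coe_toNNReal _ hVpos.le] at h
    exact h
  have hmain := measure_forall_add_le (μ := gueParamMeasure n) (G := G) (R := R) (S := S) (T := T)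
    (τ := u * √V) (ρ := ρ)
    (P := ENNReal.ofReal (1 - Real.exp (-(u + 1) ^ 2 / 2) / √(2 * Real.pi)))
    (q := ENNReal.ofReal (8 * n * (1 - w.re) / ρ ^ 2))
    (fun _ => measurable_paramLin _)
    (iIndepFun_paramLin _ fun a b hab => by
      rw [sum_const_mul_hermCoef_mul hs (hcross a) (hcross b)]
      simp [crossPart_mul_crossPart U y d hab])
    (fun a _ b _ => indepFun_paramLin _ _ fun c => by
      rw [sum_const_mul_hermCoef_mul hs (hcross c) (hblock a b)]
      simp [crossPart_mul_blockPart])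
    (fun a ha => htail a (Finset.mem_union_left _ ha))
    (fun b hb => htail b (Finset.mem_union_right _ hb))
    (fun a ha b hb => by
      have hab : a ≠ b := fun h => Finset.disjoint_left.1 hdisj ha (h ▸ hb)
      refine (measure_gaussian_le_neg (measurable_paramLin _)
        (map_paramLin_hermCoef hs (hblock a b)) hρ).trans (ENNReal.ofReal_le_ofReal ?_)
      gcongr
      rw [Real.coe_toNNReal _ (Finset.sum_nonneg fun i _ => Finset.sum_nonneg fun j _ =>
        Complex.normSq_nonneg _)]
      obtain ⟨h1, h2, h3⟩ := hz a ha b hb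
      refine le_trans ?_ (sum_normSq_outerDiff_swap_le hab hw hy h1 (hS a ha) h2 (hT b hb) h3)
      refine Finset.sum_le_sum fun i _ => Finset.sum_le_sum fun j _ => ?_
      unfold blockPart
      split_ifs
      · exact le_rfl
      · simpa using Complex.normSq_nonneg _)
  rw [hSr, hTr, ← two_mul] at hmain
  refine (measure_mono fun A hA a ha b hb => ?_).trans hmain
  have hab : a ≠ b := fun h => Finset.disjoint_left.1 hdisj ha (h ▸ hb)
  obtain ⟨h1, h2, h3⟩ := hz a ha b hb
  have hdec := outerDiff_eq_add (d := d) (Finset.mem_union_left T ha) (Finset.mem_union_right S hb)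
    hab h1 (by rw [h2, hS a ha, hdS a ha]; ring) (by rw [h3, hT b hb, hdT b hb]; ring)
  have hA' := hA a ha b hb
  simp only [G, R, paramLin_const_mul]
  rw [paramLin_hermCoef (hcross a), paramLin_hermCoef (hcross b), paramLin_hermCoef (hblock a b),
    ← mul_add, ← mul_add]
  convert! hA' using 2
  simp_rw [← Finset.sum_add_distrib]
  refine Finset.sum_congr rfl fun i _ => Finset.sum_congr rfl fun j _ => ?_
  rw [hdec i j, map_add, map_add, mul_add, mul_add, Complex.add_re, Complex.add_re]

theorem normSq_rootUnity (k : ℕ) (m : Fin k) : Complex.normSq (rootUnity k m) = 1 := by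
  rw [Complex.normSq_eq_norm_sq, rootUnity,
    show 2 * (Real.pi : ℂ) * Complex.I * ((m : ℕ) : ℂ) / (k : ℂ) =
      ((2 * Real.pi * (m : ℕ) / k : ℝ) : ℂ) * Complex.I by push_cast; ring,
    Complex.norm_exp_ofReal_mul_I, one_pow]

theorem rootUnity_zero {k : ℕ} (hk : 0 < k) : rootUnity k ⟨0, hk⟩ = 1 := by
  simp [rootUnity]

theorem rootUnity_one_re {k : ℕ} (hk : 1 < k) :
    (rootUnity k ⟨1, hk⟩).re = Real.cos (2 * Real.pi / k) := by
  rw [rootUnity, show 2 * (Real.pi : ℂ) * Complex.I * ((1 : ℕ) : ℂ) / (k : ℂ) =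
    ((2 * Real.pi / k : ℝ) : ℂ) * Complex.I by push_cast; ring, Complex.exp_ofReal_mul_I_re]

theorem cos_two_pi_div_lt_one {k : ℕ} (hk : 2 ≤ k) : Real.cos (2 * Real.pi / k) < 1 := by
  have hk' : (2 : ℝ) ≤ k := by exact_mod_cast hk
  have h := Real.cos_lt_cos_of_nonneg_of_le_pi (x := 0) (y := 2 * Real.pi / k) le_rfl
    (by rw [div_le_iff₀ (by linarith)]; nlinarith [Real.pi_pos])
    (by have := Real.pi_pos; positivity)
  rwa [Real.cos_zero] at h

theorem two_mul_sum_re_le_of_frobSqC_le {n : ℕ} {W D : Fin n → Fin n → ℂ} {σ : ℝ}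
    (h : frobSqC (fun a b => (σ : ℂ) * W a b) ≤ frobSqC (fun a b => (σ : ℂ) * W a b - D a b)) :
    2 * (σ * ∑ i, ∑ j, (W i j * (starRingEnd ℂ) (D i j)).re) ≤
      ∑ i, ∑ j, Complex.normSq (D i j) := by
  have key : ∀ i j, Complex.normSq ((σ : ℂ) * W i j - D i j) = Complex.normSq ((σ : ℂ) * W i j) +
      Complex.normSq (D i j) - 2 * σ * (W i j * (starRingEnd ℂ) (D i j)).re := by
    intro i j
    rw [Complex.normSq_sub, mul_assoc (σ : ℂ), Complex.re_ofReal_mul]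
    ring
  simp only [frobSqC, key, Finset.sum_sub_distrib, Finset.sum_add_distrib, ← Finset.mul_sum] at h
  linarith

theorem Pmat_congr {n k : ℕ} {x y : Fin n → Fin k} {c : ℂ} (hc : c * (starRingEnd ℂ) c = 1)
    (h : ∀ l, c * rootUnity k (x l) = rootUnity k (y l)) : Pmat k x = Pmat k y := by
  funext a b
  rw [Pmat, Pmat, ← h a, ← h b, map_mul]
  linear_combination (-(rootUnity k (x a) * (starRingEnd ℂ) (rootUnity k (x b)))) * hc

theorem frobSqC_le_of_forall_minimizer {n k : ℕ} {y : Fin n → Fin k} {U : Fin n → Fin n → ℂ}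
    {p : (Fin n → Fin k) → Prop}
    (h : ∀ x, p x → (∀ z, p z → frobSqC (fun a b => U a b - Pmat k x a b) ≤
      frobSqC (fun a b => U a b - Pmat k z a b)) →
      ∃ α : ℝ, ∀ l, Complex.exp ((α : ℂ) * Complex.I) * rootUnity k (x l) = rootUnity k (y l))
    {z : Fin n → Fin k} (hz : p z) :
    frobSqC (fun a b => U a b - Pmat k y a b) ≤ frobSqC (fun a b => U a b - Pmat k z a b) := by
  classical
  obtain ⟨x, hx, hmin⟩ := Finset.exists_min_image (univ.filter p)
    (fun x => frobSqC (fun a b => U a b - Pmat k x a b)) ⟨z, by simpa using hz⟩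
  obtain ⟨α, hα⟩ := h x (by simpa using hx) fun z hz => hmin z (by simpa using hz)
  have hα1 : Complex.exp (α * Complex.I) * (starRingEnd ℂ) (Complex.exp (α * Complex.I)) = 1 := by
    rw [Complex.mul_conj, Complex.normSq_eq_norm_sq, Complex.norm_exp_ofReal_mul_I]
    simp
  rw [← Pmat_congr hα1 hα]
  exact hmin z (by simpa using hz)

theorem colorCard_comp_perm {n k : ℕ} (x : Fin n → Fin k) (e : Equiv.Perm (Fin n)) (i : Fin k) :
    colorCard (x ∘ e) i = colorCard x i :=
  Finset.card_equiv e (by simp)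

/-- The noise level exceeding the threshold leaves room for the parameters of the second moment
bound. -/
theorem exists_supercritical_constants {δ : ℝ} (hδ : 0 < δ) :
    ∃ ε > 0, ∃ κ > 0, κ ^ 2 < 2 ∧ ∃ q : ℕ, 2 ≤ q ∧
      √(2 / (1 + δ)) + ε / 4 ≤ κ * √(1 - 1 / (q : ℝ)) := by
  set t := √(2 / (1 + δ)) with ht
  have ht0 : 0 ≤ t := Real.sqrt_nonneg _
  have ht2 : t < √2 := by
    refine Real.sqrt_lt_sqrt (by positivity) ?_
    rw [div_lt_iff₀ (by linarith)]
    linarith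
  have hs : √(2 : ℝ) ^ 2 = 2 := Real.sq_sqrt (by norm_num)
  have hlim : Tendsto (fun q : ℕ => (t + √2) / 2 * √(1 - 1 / (q : ℝ))) atTop
      (nhds ((t + √2) / 2)) := by
    have h := (((tendsto_one_div_atTop_nhds_zero_nat (𝕜 := ℝ)).const_sub 1).sqrt).const_mul
      ((t + √2) / 2)
    simpa using h
  have hev := hlim.eventually (lt_mem_nhds (show (t + (t + √2) / 2) / 2 < (t + √2) / 2 by linarith))
  obtain ⟨q, hq, hq2⟩ := (hev.and (eventually_ge_atTop 2)).exists
  refine ⟨√2 - t, by linarith, (t + √2) / 2, by linarith, by nlinarith, q, hq2, ?_⟩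
  linarith

theorem measure_forall_minimizer_le {n k m q : ℕ} (hn : n = k * m) (hk : 2 ≤ k)
    (hm : 1 ≤ m) (hq : 2 ≤ q)
    {y : Fin n → Fin k} (hy : ∀ i, colorCard y i = m) {σ δ ε κ : ℝ} (hδ : 0 < δ)
    (hε : 0 < ε) (hκ : 0 < κ) (hconst : √(2 / (1 + δ)) + ε / 4 ≤ κ * √(1 - 1 / (q : ℝ)))
    (hσ : σ ^ 2 > (1 + δ) * n * (1 - Real.cos (2 * Real.pi / k)) /
        (2 * Real.log n)) :
    gueParamMeasure n
      {A | ∀ x : Fin n → Fin k, (∀ i, colorCard x i = m) →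
        (∀ z : Fin n → Fin k, (∀ i, colorCard z i = m) →
          frobSqC (fun a b => (Pmat k y a b + (σ : ℂ) * gueOfParam A a b) - Pmat k x a b) ≤
          frobSqC (fun a b => (Pmat k y a b + (σ : ℂ) * gueOfParam A a b) - Pmat k z a b)) →
        ∃ α : ℝ, ∀ l : Fin n,
          Complex.exp ((α : ℂ) * Complex.I) * rootUnity k (x l) = rootUnity k (y l)} ≤
      2 * ENNReal.ofReal (1 - Real.exp (-(κ * √(Real.log n) + 1) ^ 2 / 2) /
        √(2 * Real.pi)) ^ (m / q) + ENNReal.ofReal (8 / (ε ^ 2 * Real.log n)) := by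
  set c := Real.cos (2 * Real.pi / k) with hc
  have hc1 : c < 1 := cos_two_pi_div_lt_one hk
  have hn2 : 2 ≤ n := by nlinarith
  have hnR : (2 : ℝ) ≤ n := by exact_mod_cast hn2
  set ℓ := Real.log n with hℓ
  have hℓ0 : 0 < ℓ := Real.log_pos (by linarith)
  set N : ℝ := n * (1 - c) with hN
  have hN0 : 0 < N := mul_pos (by linarith) (by linarith)
  set w := rootUnity k ⟨1, hk⟩ with hw
  have hwre : w.re = c := rootUnity_one_re hk
  have hw1 : w ≠ 1 := fun h => by rw [h, Complex.one_re] at hwre; linarith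
  have hk0 : 0 < k := by omega
  obtain ⟨S, hSsub, hScard⟩ := Finset.exists_subset_card_eq
    (s := univ.filter fun v => y v = ⟨0, hk0⟩) (n := m / q)
    ((Nat.div_le_self m q).trans (hy ⟨0, hk0⟩).ge)
  obtain ⟨T, hTsub, hTcard⟩ := Finset.exists_subset_card_eq
    (s := univ.filter fun v => y v = ⟨1, hk⟩) (n := m / q)
    ((Nat.div_le_self m q).trans (hy ⟨1, hk⟩).ge)
  have hS : ∀ a ∈ S, y a = ⟨0, hk0⟩ := fun a ha => by simpa using hSsub ha
  have hT : ∀ b ∈ T, y b = ⟨1, hk⟩ := fun b hb => by simpa using hTsub hb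
  have hqr : q * (m / q) ≤ m := Nat.mul_div_le m q
  have hqR : (2 : ℝ) ≤ q := by exact_mod_cast hq
  have hrn : 2 * ((m / q : ℕ) : ℝ) ≤ n / q := by
    rw [le_div_iff₀ (by linarith)]
    have h1 : q * (m / q) * 2 ≤ n := by nlinarith
    have h2 : ((q * (m / q) * 2 : ℕ) : ℝ) ≤ n := by exact_mod_cast h1
    push_cast at h2
    linarith
  have hr : 2 * (m / q) < n := by nlinarith
  set t := √(2 / (1 + δ)) with ht
  have ht2 : t ^ 2 = 2 / (1 + δ) := Real.sq_sqrt (by positivity)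
  set V : ℝ := 4 * (n - 2 * ((m / q : ℕ) : ℝ)) * (1 - w.re) with hV
  set X := √(N * ℓ) with hX
  have hX2 : X ^ 2 = N * ℓ := Real.sq_sqrt (by positivity)
  have hX0 : 0 < X := Real.sqrt_pos.2 (by positivity)
  have hVX : 2 * √(1 - 1 / (q : ℝ)) * X ≤ √ℓ * √V := by
    have hq1 : 0 ≤ 1 - 1 / (q : ℝ) := by
      rw [sub_nonneg, div_le_one (by linarith)]; linarith
    rw [← Real.sqrt_mul hℓ0.le]
    refine Real.le_sqrt_of_sq_le ?_
    rw [mul_pow, mul_pow, Real.sq_sqrt hq1, hX2, hV, hwre, hN]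
    have : (n : ℝ) * (1 - 1 / q) ≤ n - 2 * ((m / q : ℕ) : ℝ) := by
      rw [mul_sub, mul_one_div, mul_one]; linarith
    have h := mul_le_mul_of_nonneg_right this (mul_nonneg hℓ0.le (sub_nonneg.2 hc1.le))
    linarith
  have hthr : 4 * t * X ≤ 2 * (κ * √ℓ * √V) - ε * X := by
    have h1 := mul_le_mul_of_nonneg_left hVX hκ.le
    have h2 := mul_le_mul_of_nonneg_right hconst hX0.le
    linarith
  obtain ⟨s, hs, hsσ⟩ : ∃ s : ℝ, s ^ 2 = 1 ∧ s * |σ| = σ := by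
    rcases le_total 0 σ with h | h
    · exact ⟨1, by norm_num, by rw [abs_of_nonneg h, one_mul]⟩
    · exact ⟨-1, by norm_num, by rw [abs_of_nonpos h]; ring⟩
  have hσN : N < σ ^ 2 * t ^ 2 * ℓ := by
    have h : (1 + δ) * n * (1 - c) < σ ^ 2 * (2 * ℓ) := (div_lt_iff₀ (by positivity)).1 hσ
    rw [ht2, mul_div_assoc', div_mul_eq_mul_div, lt_div_iff₀ (by linarith), hN]
    linarith
  have hbound := measure_forall_swap_le (y := fun i => rootUnity k (y i)) (w := w) (S := S)
    (T := T) (r := m / q) (s := s) (u := κ * √ℓ) (ρ := ε * X) (V := V) (normSq_rootUnity k _) hw1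
    (fun i => normSq_rootUnity k _) (fun a ha => by rw [hS a ha, rootUnity_zero])
    (fun b hb => by rw [hT b hb]) hScard hTcard hr hs (by positivity) (by positivity) hV
    (fun a b i => rootUnity k (y (Equiv.swap a b i)))
    (fun a ha b hb => ⟨fun i h1 h2 => by rw [Equiv.swap_apply_of_ne_of_ne h1 h2],
      by rw [Equiv.swap_apply_left, hT b hb], by rw [Equiv.swap_apply_right, hS a ha,
        rootUnity_zero]⟩)
  have hvar : 8 * n * (1 - w.re) / (ε * X) ^ 2 = 8 / (ε ^ 2 * ℓ) := by
    rw [mul_pow, hX2, hwre, mul_assoc, ← hN]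
    field_simp
  rw [hvar] at hbound
  refine (measure_mono fun A hA a ha b hb => ?_).trans hbound
  refine le_trans ?_ hthr
  have hab : a ≠ b := by
    rintro rfl
    simpa using (hS a ha).symm.trans (hT a hb)
  have hle := frobSqC_le_of_forall_minimizer hA (z := y ∘ Equiv.swap a b) fun i =>
    (colorCard_comp_perm y _ i).trans (hy i)
  set D := outerDiff (fun i => rootUnity k (y (Equiv.swap a b i))) fun i => rootUnity k (y i)
    with hD
  have hgain := two_mul_sum_re_le_of_frobSqC_le (W := gueOfParam A) (D := D) (σ := σ) (by
    convert! hle using 3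
    · simp
    · rename_i i; funext j
      simp only [hD, outerDiff, Pmat, Function.comp]
      ring)
  have hD2 : ∑ i, ∑ j, Complex.normSq (D i j) ≤ 8 * n * (1 - w.re) :=
    sum_normSq_outerDiff_swap_le hab (normSq_rootUnity k _) (fun i => normSq_rootUnity k _)
      (fun i h1 h2 => by rw [Equiv.swap_apply_of_ne_of_ne h1 h2])
      (by rw [hS a ha, rootUnity_zero]) (by rw [Equiv.swap_apply_left, hT b hb])
      (by rw [hT b hb]) (by rw [Equiv.swap_apply_right, hS a ha, rootUnity_zero])
  set L := ∑ i, ∑ j, (gueOfParam A i j * (starRingEnd ℂ) (D i j)).re with hL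
  rw [hwre] at hD2
  have hsL : |σ| * (s * L) ≤ 4 * N := by
    have : |σ| * (s * L) = σ * L := by rw [← mul_assoc, mul_comm |σ|, hsσ]
    rw [this, hN]; linarith
  by_contra! hcon
  have h1 : |σ| * (4 * t * X) ≤ 4 * N :=
    (mul_le_mul_of_nonneg_left hcon.le (abs_nonneg σ)).trans hsL
  have h2 : (|σ| * t * X) ^ 2 ≤ N ^ 2 := by
    refine pow_le_pow_left₀ (by positivity) ?_ 2
    linarith
  rw [mul_pow, mul_pow, sq_abs, hX2] at h2
  nlinarith

theorem tendsto_sub_sq_div_two_atTop {κ : ℝ} (hκ : κ ^ 2 < 2) :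
    Tendsto (fun ℓ : ℝ => ℓ - (κ * √ℓ + 1) ^ 2 / 2) atTop atTop := by
  have h1 : Tendsto (fun x : ℝ => x * ((1 - κ ^ 2 / 2) * x - κ) - 1 / 2) atTop atTop := by
    refine tendsto_atTop_add_const_right _ _ (tendsto_id.atTop_mul_atTop₀ ?_)
    exact tendsto_atTop_add_const_right _ _ (tendsto_id.const_mul_atTop (by linarith))
  refine (h1.comp Real.tendsto_sqrt_atTop).congr' ?_
  filter_upwards [eventually_ge_atTop 0] with ℓ hℓ
  have := Real.sq_sqrt hℓ
  simp only [Function.comp]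
  linear_combination this

theorem tendsto_one_sub_gaussian_tail_pow {k q : ℕ} (hk : 0 < k) (hq : 0 < q) {κ : ℝ}
    (hκ : κ ^ 2 < 2) :
    Tendsto (fun m : ℕ => ENNReal.ofReal (1 - Real.exp (-(κ * √(Real.log (k * m : ℕ)) + 1) ^ 2 / 2)
      / √(2 * Real.pi)) ^ (m / q)) atTop (nhds 0) := by
  have hkm : Tendsto (fun m : ℕ => ((k * m : ℕ) : ℝ)) atTop atTop :=
    tendsto_natCast_atTop_atTop.comp (tendsto_id.const_mul_atTop' hk)
  have hlog := Real.tendsto_log_atTop.comp hkm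
  have hexp := Real.tendsto_exp_atTop.comp ((tendsto_sub_sq_div_two_atTop hκ).comp hlog)
  have hC : (0 : ℝ) < 1 / (√(2 * Real.pi) * (2 * q * k)) := by positivity
  have hlim := ENNReal.tendsto_ofReal (Real.tendsto_exp_neg_atTop_nhds_zero.comp
    (hexp.const_mul_atTop hC))
  rw [ENNReal.ofReal_zero] at hlim
  refine tendsto_of_tendsto_of_tendsto_of_le_of_le' tendsto_const_nhds hlim
    (Eventually.of_forall fun _ => zero_le) ?_
  filter_upwards [eventually_ge_atTop q] with m hm
  set ℓ := Real.log (k * m : ℕ) with hℓ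
  set p := Real.exp (-(κ * √ℓ + 1) ^ 2 / 2) / √(2 * Real.pi) with hp
  have hp0 : 0 ≤ p := by positivity
  have hm0 : 0 < m := by omega
  have hr : (m : ℝ) ≤ 2 * q * ((m / q : ℕ) : ℝ) := by
    have h1 := Nat.div_add_mod m q
    have h2 := Nat.mod_lt m hq
    have h3 : 1 ≤ m / q := (Nat.one_le_div_iff hq).2 hm
    have h4 : m ≤ 2 * q * (m / q) := by nlinarith
    exact_mod_cast h4
  have hexpℓ : Real.exp ℓ = k * m := by
    rw [hℓ, Real.exp_log (by positivity)]; push_cast; ring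
  calc ENNReal.ofReal (1 - p) ^ (m / q) ≤ ENNReal.ofReal (Real.exp (-p)) ^ (m / q) := by
        gcongr
        exact Real.one_sub_le_exp_neg p
    _ = ENNReal.ofReal (Real.exp (-(((m / q : ℕ) : ℝ) * p))) := by
        rw [← ENNReal.ofReal_pow (Real.exp_nonneg _), ← Real.exp_nat_mul, mul_neg]
    _ ≤ _ := by
        refine ENNReal.ofReal_le_ofReal (Real.exp_le_exp.2 (neg_le_neg ?_))
        simp only [Function.comp]
        rw [← hℓ, sub_eq_add_neg, Real.exp_add, hexpℓ, ← neg_div,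
          show 1 / (√(2 * Real.pi) * (2 * q * k)) * (k * m * Real.exp (-(κ * √ℓ + 1) ^ 2 / 2)) =
            m / (2 * q) * p by rw [hp]; field_simp]
        refine mul_le_mul_of_nonneg_right ?_ hp0
        rw [div_le_iff₀ (by positivity)]
        linarith

theorem tendsto_ofReal_div_log_zero {k : ℕ} (hk : 0 < k) {ε : ℝ} (hε : 0 < ε) :
    Tendsto (fun m : ℕ => ENNReal.ofReal (8 / (ε ^ 2 * Real.log (k * m : ℕ)))) atTop (nhds 0) := by
  have hkm : Tendsto (fun m : ℕ => ((k * m : ℕ) : ℝ)) atTop atTop :=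
    tendsto_natCast_atTop_atTop.comp (tendsto_id.const_mul_atTop' hk)
  have h := ENNReal.tendsto_ofReal (((Real.tendsto_log_atTop.comp hkm).const_mul_atTop
    (pow_pos hε 2)).const_div_atTop 8)
  rwa [ENNReal.ofReal_zero] at h

theorem gue_mle_supercritical
    (k : ℕ) (hk : 2 ≤ k)
    (y : (m : ℕ) → Fin (k * m) → Fin k)
    (hy : ∀ m : ℕ, ∀ i : Fin k, colorCard (y m) i = m)
    (σ : ℕ → ℝ) (δ : ℝ) (hδ : 0 < δ)
    (hσ : ∀ m : ℕ, 1 ≤ m →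
      σ m ^ 2 > (1 + δ) * (k * m : ℕ) * (1 - Real.cos (2 * Real.pi / k)) /
        (2 * Real.log (k * m : ℕ))) :
    Tendsto (fun m : ℕ => gueParamMeasure (k * m)
      {A | ∀ x : Fin (k * m) → Fin k, (∀ i, colorCard x i = m) →
        (∀ z : Fin (k * m) → Fin k, (∀ i, colorCard z i = m) →
          frobSqC (fun a b => (Pmat k (y m) a b + (σ m : ℂ) * gueOfParam A a b) - Pmat k x a b) ≤
          frobSqC (fun a b => (Pmat k (y m) a b + (σ m : ℂ) * gueOfParam A a b) - Pmat k z a b)) →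
        ∃ α : ℝ, ∀ l : Fin (k * m),
          Complex.exp ((α : ℂ) * Complex.I) * rootUnity k (x l) = rootUnity k (y m l)})
      atTop (nhds 0) := by
  obtain ⟨ε, hε, κ, hκ, hκ2, q, hq, hconst⟩ := exists_supercritical_constants hδ
  have hk0 : 0 < k := by omega
  have hlim := (ENNReal.Tendsto.const_mul (a := 2)
    (tendsto_one_sub_gaussian_tail_pow hk0 (by omega : 0 < q) hκ2)
    (Or.inr (by simp))).add (tendsto_ofReal_div_log_zero hk0 hε)
  rw [mul_zero, add_zero] at hlim
  refine tendsto_of_tendsto_of_tendsto_of_le_of_le' tendsto_const_nhds hlim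
    (Eventually.of_forall fun _ => zero_le) ?_
  filter_upwards [eventually_ge_atTop 1] with m hm
  exact measure_forall_minimizer_le rfl hk hm hq (hy m) hδ hε hκ hconst (hσ m hm)
end

section
/- For each n, let d_1,…,d_k ∈ [0,2π) be distinct (k ≥ 2 may depend on n), let y_n : {1,…,n} → {e^{i d_1},…,e^{i d_k}} be the true color assignment, and let V_n = P(y_n) + σ_n·diag(y_n) W_s diag(conj(y_n)) be the observation, where W_s is a standard GOE matrix. If there is a constant δ > 0 (independent of n) such that σ_n < (1−δ)·√n/√(2 log n) for all n, then the probability that the matrix y_n · conj(y_n)ᵗ is the unique maximizer of Re⟨V_n, X⟩ over all n×n positive semidefinite Hermitian matrices X with X_{ii} = 1 for all i tends to 1 as n → ∞. -/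
open MeasureTheory ProbabilityTheory Filter Finset
open scoped ComplexOrder

/-- The law of an `n × n` random matrix whose `n²` entries are i.i.d. standard Gaussians.
The coordinates with `i ≤ j` parametrize a standard GOE matrix via `symOfParam`. -/
noncomputable def gaussMatrix (n : ℕ) : Measure (Fin n → Fin n → ℝ) :=
  Measure.pi fun _ : Fin n => Measure.pi fun _ : Fin n => gaussianReal 0 1

/-- The symmetric (GOE) matrix built from the real parameters `A`: its diagonal and
strictly upper-triangular entries are the corresponding entries of `A` (i.i.d. `N(0,1)`
under `gaussMatrix n`), and it is symmetric. -/
noncomputable def symOfParam {n : ℕ} (A : Fin n → Fin n → ℝ) : Fin n → Fin n → ℝ :=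
  fun i j => if (i : ℕ) ≤ (j : ℕ) then A i j else A j i

/-- The observation `V = P(y) + σ diag(y) Wₛ diag(conj y)`, whose `(i,j)` entry is
`y(i) conj(y(j)) + σ y(i) Wₛ(i,j) conj(y(j))`, where `Wₛ = symOfParam A` is the GOE matrix. -/
noncomputable def sdpObs {n : ℕ} (σ : ℝ) (yv : Fin n → ℂ) (A : Fin n → Fin n → ℝ) :
    Fin n → Fin n → ℂ :=
  fun i j => yv i * (starRingEnd ℂ) (yv j) +
    (σ : ℂ) * yv i * (symOfParam A i j : ℂ) * (starRingEnd ℂ) (yv j)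

/-- A finite subset of the ball of radius `2`, of size at most `5 ^ dim`, which is a `1`-net. -/
lemma exists_net_closedBall (E : Type*) [NormedAddCommGroup E] [NormedSpace ℝ E]
    [FiniteDimensional ℝ E] :
    ∃ N : Finset E, N.card ≤ 5 ^ Module.finrank ℝ E ∧ (∀ c ∈ N, ‖c‖ ≤ 2) ∧
      ∀ v : E, ‖v‖ ≤ 2 → ∃ c ∈ N, ‖v - c‖ ≤ 1 := by
  classical
  let p : ℕ → Prop := fun m => ∃ N : Finset E, N.card = m ∧ (∀ c ∈ N, ‖c‖ ≤ 2) ∧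
    ∀ c ∈ N, ∀ c' ∈ N, c ≠ c' → 1 ≤ ‖c - c'‖
  have hp0 : p 0 := ⟨∅, by simp⟩
  obtain ⟨N, hcard, hball, hsep⟩ :=
    Nat.findGreatest_spec (P := p) (Nat.zero_le (5 ^ Module.finrank ℝ E)) hp0
  refine ⟨N, Besicovitch.card_le_of_separated N hball hsep, hball, fun v hv => ?_⟩
  by_contra! hfar
  have hvN : v ∉ N := fun h => by
    have := hfar v h
    simp only [sub_self, norm_zero] at this
    linarith
  have hball' : ∀ c ∈ insert v N, ‖c‖ ≤ 2 := by
    intro c hc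
    rcases Finset.mem_insert.1 hc with rfl | hc
    exacts [hv, hball c hc]
  have hsep' : ∀ c ∈ insert v N, ∀ c' ∈ insert v N, c ≠ c' → 1 ≤ ‖c - c'‖ := by
    intro c hc c' hc' hne
    rcases Finset.mem_insert.1 hc with h | h <;> rcases Finset.mem_insert.1 hc' with h' | h'
    · exact absurd (h.trans h'.symm) hne
    · rw [h]; exact (hfar c' h').le
    · rw [h', norm_sub_rev]; exact (hfar c h).le
    · exact hsep c h c' h' hne
  have hle := Besicovitch.card_le_of_separated _ hball' hsep'
  have hmax := Nat.le_findGreatest (P := p) hle ⟨_, rfl, hball', hsep'⟩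
  rw [Finset.card_insert_of_notMem hvN] at hmax
  omega

/-- The operator norm is controlled by the bilinear form on a `1`-net of the ball of radius `2`. -/
lemma opNorm_le_of_net {E : Type*} [NormedAddCommGroup E] [InnerProductSpace ℝ E]
    {N : Finset E} (hN : ∀ v : E, ‖v‖ ≤ 2 → ∃ c ∈ N, ‖v - c‖ ≤ 1)
    (T : E →L[ℝ] E) {s : ℝ} (hs : 0 ≤ s) (h : ∀ u ∈ N, ∀ v ∈ N, inner ℝ u (T v) ≤ s) :
    ‖T‖ ≤ s := by
  have key : ∀ w : E, (∀ u ∈ N, inner ℝ u w ≤ s) → ‖w‖ ≤ s := by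
    intro w hw
    rcases eq_or_ne w 0 with rfl | hw0
    · simpa using hs
    have hpos : 0 < ‖w‖ := norm_pos_iff.2 hw0
    have hnorm : ‖(2 / ‖w‖) • w‖ ≤ 2 := by
      rw [norm_smul, Real.norm_of_nonneg (by positivity), div_mul_cancel₀ _ hpos.ne']
    obtain ⟨c, hc, hdist⟩ := hN _ hnorm
    have h1 : inner ℝ ((2 / ‖w‖) • w) w = 2 * ‖w‖ := by
      rw [real_inner_smul_left, real_inner_self_eq_norm_sq]
      field_simp
    have h2 : inner ℝ ((2 / ‖w‖) • w - c) w ≤ 1 * ‖w‖ :=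
      (real_inner_le_norm _ _).trans (by gcongr)
    rw [inner_sub_left, h1] at h2
    linarith [hw c hc]
  have hunit : ‖T‖ ≤ (s + ‖T‖) / 2 := by
    refine T.opNorm_le_of_unit_norm (by positivity) fun v hv => ?_
    obtain ⟨c, hc, hdist⟩ := hN ((2 : ℝ) • v) (by rw [norm_smul, hv]; simp)
    have h1 : ‖T ((2 : ℝ) • v - c)‖ ≤ ‖T‖ * 1 :=
      (T.le_opNorm _).trans (by gcongr)
    have h2 : ‖T c‖ ≤ s := key _ fun u hu => h u hu c hc
    have h3 : ‖T ((2 : ℝ) • v)‖ = 2 * ‖T v‖ := by rw [map_smul, norm_smul]; simp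
    have h4 : ‖T ((2 : ℝ) • v)‖ ≤ ‖T ((2 : ℝ) • v - c)‖ + ‖T c‖ := by
      rw [map_sub]; simpa using norm_add_le (T ((2 : ℝ) • v) - T c) (T c)
    linarith
  linarith

/-- Gaussian tail bound for linear functionals of the entries of a Gaussian matrix. -/
lemma gaussMatrix_linear_tail {n : ℕ} (c : Fin n → Fin n → ℝ) {C t : ℝ} (hC : 0 < C)
    (hc : ∑ i, ∑ j, c i j ^ 2 ≤ C) (ht : 0 ≤ t) :
    gaussMatrix n {A | t ≤ ∑ i, ∑ j, c i j * A i j} ≤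
      ENNReal.ofReal (Real.exp (-(t ^ 2 / (2 * C)))) := by
  have hprob : IsProbabilityMeasure (gaussMatrix n) := by unfold gaussMatrix; infer_instance
  let X : (Fin n → Fin n → ℝ) → ℝ := fun A => ∑ i, ∑ j, c i j * A i j
  have hexp : ∀ r : ℝ, (fun A => Real.exp (r * X A)) =
      fun A : Fin n → Fin n → ℝ => ∏ i, ∏ j, Real.exp (r * c i j * A i j) := by
    intro r
    ext A
    simp_rw [X, ← Real.exp_sum, Finset.mul_sum, mul_assoc]
  have hint : ∀ r : ℝ, Integrable (fun A => Real.exp (r * X A)) (gaussMatrix n) := by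
    intro r
    rw [hexp]
    unfold gaussMatrix
    exact Integrable.fintype_prod (f := fun i (a : Fin n → ℝ) => ∏ j, Real.exp (r * c i j * a j))
      fun i => Integrable.fintype_prod (f := fun j (x : ℝ) => Real.exp (r * c i j * x))
        fun j => integrable_exp_mul_gaussianReal _
  have hmgf : ∀ r : ℝ, mgf X (gaussMatrix n) r =
      Real.exp (r ^ 2 * (∑ i, ∑ j, c i j ^ 2) / 2) := by
    intro r
    have hg : ∀ i j, ∫ x, Real.exp (r * c i j * x) ∂(gaussianReal 0 1) =
        Real.exp (r ^ 2 * c i j ^ 2 / 2) := by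
      intro i j
      have := congrFun (mgf_id_gaussianReal (μ := 0) (v := 1)) (r * c i j)
      simp only [mgf, id_eq] at this
      rw [this]
      congr 1
      push_cast
      ring
    rw [mgf, hexp]
    unfold gaussMatrix
    rw [integral_fintype_prod_eq_prod (𝕜 := ℝ)
      (f := fun i (a : Fin n → ℝ) => ∏ j, Real.exp (r * c i j * a j))]
    have : ∀ i, ∫ a : Fin n → ℝ, ∏ j, Real.exp (r * c i j * a j)
        ∂(Measure.pi fun _ => gaussianReal 0 1) = ∏ j, Real.exp (r ^ 2 * c i j ^ 2 / 2) := by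
      intro i
      rw [integral_fintype_prod_eq_prod (𝕜 := ℝ) (f := fun j (x : ℝ) => Real.exp (r * c i j * x))]
      simp_rw [hg]
    simp_rw [this, ← Real.exp_sum, Finset.mul_sum, Finset.sum_div]
  have hch := measure_ge_le_exp_mul_mgf (μ := gaussMatrix n) (X := X) t
    (t := t / C) (by positivity) (hint _)
  rw [hmgf, ← Real.exp_add] at hch
  rw [← ENNReal.ofReal_toReal (measure_ne_top (gaussMatrix n) _)]
  refine ENNReal.ofReal_le_ofReal (hch.trans (Real.exp_le_exp.2 ?_))
  have h1 : (t / C) ^ 2 * (∑ i, ∑ j, c i j ^ 2) / 2 ≤ (t / C) ^ 2 * C / 2 := by gcongr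
  have h2 : (t / C) ^ 2 * C / 2 = t ^ 2 / (2 * C) := by field_simp
  have h3 : -(t / C) * t = -(2 * (t ^ 2 / (2 * C))) := by field_simp
  linarith

/-- The coefficients of `∑ g i j * W i j` in terms of the parameters of the symmetric matrix `W`. -/
noncomputable def foldUpper {n : ℕ} (g : Fin n → Fin n → ℝ) (i j : Fin n) : ℝ :=
  (if (i : ℕ) ≤ j then g i j else 0) + if (i : ℕ) < j then g j i else 0

lemma sum_mul_symOfParam {n : ℕ} (g A : Fin n → Fin n → ℝ) :
    ∑ i, ∑ j, g i j * symOfParam A i j = ∑ i, ∑ j, foldUpper g i j * A i j := by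
  have h1 : ∀ i j, g i j * symOfParam A i j =
      (if (i : ℕ) ≤ j then g i j else 0) * A i j + (if (j : ℕ) < i then g i j else 0) * A j i := by
    intro i j
    unfold symOfParam
    by_cases h : (i : ℕ) ≤ j
    · simp [h, not_lt.2 h]
    · simp [h, not_le.1 h]
  simp_rw [h1, foldUpper, add_mul, Finset.sum_add_distrib]
  congr 1
  exact Finset.sum_comm

lemma sum_foldUpper_sq_le {n : ℕ} (g : Fin n → Fin n → ℝ) :
    ∑ i, ∑ j, foldUpper g i j ^ 2 ≤ 4 * ∑ i, ∑ j, g i j ^ 2 := by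
  have h1 : ∀ i j, foldUpper g i j ^ 2 ≤ 2 * g i j ^ 2 + 2 * g j i ^ 2 := by
    intro i j
    unfold foldUpper
    split_ifs <;> nlinarith [sq_nonneg (g i j - g j i), sq_nonneg (g i j), sq_nonneg (g j i)]
  refine (Finset.sum_le_sum fun i _ => Finset.sum_le_sum fun j _ => h1 i j).trans ?_
  simp_rw [Finset.sum_add_distrib, ← Finset.mul_sum]
  rw [Finset.sum_comm (f := fun i j => g j i ^ 2)]
  linarith

lemma symOfParam_comm {n : ℕ} (A : Fin n → Fin n → ℝ) (i j : Fin n) :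
    symOfParam A i j = symOfParam A j i := by
  unfold symOfParam
  rcases lt_trichotomy (i : ℕ) j with h | h | h
  · simp [h.le, not_le.2 h]
  · rw [Fin.ext h]
  · simp [h.le, not_le.2 h]

/-- The row sums of a GOE matrix have variance `n`. -/
lemma gaussMatrix_row_tail {n : ℕ} (i : Fin n) {t : ℝ} (ht : 0 ≤ t) :
    gaussMatrix n {A | ∑ j, symOfParam A i j ≤ -t} ≤
      ENNReal.ofReal (Real.exp (-(t ^ 2 / (2 * n)))) := by
  have hn : (0 : ℝ) < n := by exact_mod_cast Fin.pos i
  let g : Fin n → Fin n → ℝ := fun a _ => if a = i then -1 else 0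
  have hrow : ∀ A : Fin n → Fin n → ℝ,
      ∑ a, ∑ b, g a b * symOfParam A a b = -∑ j, symOfParam A i j := by
    intro A
    simp [g]
  have hsq : ∑ a, ∑ b, foldUpper g a b ^ 2 ≤ n := by
    have hone : ∀ a b, foldUpper g a b ^ 2 = -(foldUpper g a b * 1) := by
      intro a b
      unfold foldUpper
      by_cases ha : a = i <;> by_cases hb : b = i
      · subst ha; subst hb; simp [g]
      all_goals
        simp only [g, ha, hb, if_true, if_false, ite_self]
        try split_ifs
        all_goals norm_num
    simp_rw [hone, Finset.sum_neg_distrib]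
    rw [← sum_mul_symOfParam g (fun _ _ => 1), hrow]
    simp [symOfParam]
  have hset : {A : Fin n → Fin n → ℝ | ∑ j, symOfParam A i j ≤ -t} =
      {A | t ≤ ∑ a, ∑ b, foldUpper g a b * A a b} := by
    ext A
    simp only [Set.mem_ofPred_eq, ← sum_mul_symOfParam, hrow]
    exact le_neg
  rw [hset]
  exact gaussMatrix_linear_tail _ hn hsq ht

lemma gaussMatrix_bilin_tail {n : ℕ} (u v : EuclideanSpace ℝ (Fin n)) (hu : ‖u‖ ≤ 2)
    (hv : ‖v‖ ≤ 2) {s : ℝ} (hs : 0 ≤ s) :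
    gaussMatrix n {A | s ≤ ∑ i, ∑ j, u i * v j * symOfParam A i j} ≤
      ENNReal.ofReal (Real.exp (-(s ^ 2 / 128))) := by
  have hu2 : ∑ i, u i ^ 2 ≤ 4 := by
    rw [← EuclideanSpace.real_norm_sq_eq]; nlinarith [norm_nonneg u]
  have hv2 : ∑ i, v i ^ 2 ≤ 4 := by
    rw [← EuclideanSpace.real_norm_sq_eq]; nlinarith [norm_nonneg v]
  have hsq : ∑ i, ∑ j, foldUpper (fun i j => u i * v j) i j ^ 2 ≤ 64 := by
    refine (sum_foldUpper_sq_le _).trans ?_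
    simp_rw [mul_pow, ← Finset.sum_mul_sum]
    have : (∑ i, u i ^ 2) * ∑ i, v i ^ 2 ≤ 4 * 4 := by
      gcongr
    linarith
  simp_rw [sum_mul_symOfParam (fun i j => u i * v j)]
  have := gaussMatrix_linear_tail _ (by norm_num : (0 : ℝ) < 64) hsq hs
  norm_num at this
  exact this

/-- With high probability the row sums and the quadratic form of a GOE matrix are controlled. -/
lemma gaussMatrix_bad_le (n : ℕ) {t s : ℝ} (ht : 0 ≤ t) (hs : 0 ≤ s) :
    gaussMatrix n {A | ¬ ((∀ i, -t ≤ ∑ j, symOfParam A i j) ∧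
        ∀ x : Fin n → ℝ, ∑ i, ∑ j, symOfParam A i j * (x i * x j) ≤ s * ∑ i, x i ^ 2)} ≤
      ENNReal.ofReal (n * Real.exp (-(t ^ 2 / (2 * n)))) +
        ENNReal.ofReal (25 ^ n * Real.exp (-(s ^ 2 / 128))) := by
  obtain ⟨N, hcard, hball, hnet⟩ := exists_net_closedBall (EuclideanSpace ℝ (Fin n))
  rw [finrank_euclideanSpace_fin] at hcard
  have hsub : {A : Fin n → Fin n → ℝ | ¬ ((∀ i, -t ≤ ∑ j, symOfParam A i j) ∧
        ∀ x : Fin n → ℝ, ∑ i, ∑ j, symOfParam A i j * (x i * x j) ≤ s * ∑ i, x i ^ 2)} ⊆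
      (⋃ i ∈ (Finset.univ : Finset (Fin n)), {A | ∑ j, symOfParam A i j ≤ -t}) ∪
      ⋃ p ∈ N ×ˢ N, {A | s ≤ ∑ i, ∑ j, p.1 i * p.2 j * symOfParam A i j} := by
    intro A hA
    by_contra hcon
    simp only [Set.mem_union, Set.mem_iUnion, not_or, not_exists, Set.mem_ofPred_eq, not_le] at hcon
    obtain ⟨hr, hb⟩ := hcon
    refine hA ⟨fun i => (hr i (Finset.mem_univ _)).le, fun x => ?_⟩
    let T := Matrix.toEuclideanCLM (n := Fin n) (𝕜 := ℝ) (Matrix.of (symOfParam A))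
    have hform : ∀ u v : EuclideanSpace ℝ (Fin n),
        inner ℝ u (T v) = ∑ i, ∑ j, u i * v j * symOfParam A i j := by
      intro u v
      simp only [T, Matrix.inner_toEuclideanCLM, dotProduct, Matrix.mulVec, Finset.mul_sum,
        Matrix.of_apply]
      exact Finset.sum_congr rfl fun i _ => Finset.sum_congr rfl fun j _ => by ring
    have hT : ‖T‖ ≤ s := opNorm_le_of_net hnet T hs fun u hu v hv => by
      rw [hform]; exact (hb (u, v) (Finset.mk_mem_product hu hv)).le
    have h1 : inner ℝ (WithLp.toLp 2 x) (T (WithLp.toLp 2 x)) ≤ s * ∑ i, x i ^ 2 := by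
      calc _ ≤ ‖WithLp.toLp 2 x‖ * (‖T‖ * ‖WithLp.toLp 2 x‖) :=
            (real_inner_le_norm _ _).trans (by gcongr; exact T.le_opNorm _)
        _ ≤ ‖WithLp.toLp 2 x‖ * (s * ‖WithLp.toLp 2 x‖) := by gcongr
        _ = s * ‖WithLp.toLp 2 x‖ ^ 2 := by ring
        _ = _ := by rw [EuclideanSpace.real_norm_sq_eq]
    rw [hform] at h1
    refine le_of_eq_of_le ?_ h1
    exact Finset.sum_congr rfl fun i _ => Finset.sum_congr rfl fun j _ => mul_comm _ _
  refine (measure_mono hsub).trans ((measure_union_le _ _).trans (add_le_add ?_ ?_))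
  · refine (measure_biUnion_finset_le _ _).trans ?_
    refine (Finset.sum_le_sum fun i _ => gaussMatrix_row_tail i ht).trans ?_
    rw [Finset.sum_const, Finset.card_univ, Fintype.card_fin, nsmul_eq_mul,
      ENNReal.ofReal_mul (by positivity), ENNReal.ofReal_natCast]
  · refine (measure_biUnion_finset_le _ _).trans ?_
    refine (Finset.sum_le_sum fun p hp => gaussMatrix_bilin_tail p.1 p.2
      (hball _ (Finset.mem_product.1 hp).1) (hball _ (Finset.mem_product.1 hp).2) hs).trans ?_
    rw [Finset.sum_const, nsmul_eq_mul, ← ENNReal.ofReal_natCast,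
      ← ENNReal.ofReal_mul (by positivity)]
    refine ENNReal.ofReal_le_ofReal (mul_le_mul_of_nonneg_right ?_ (by positivity))
    rw [Finset.card_product]
    calc ((N.card * N.card : ℕ) : ℝ) ≤ ((5 ^ n * 5 ^ n : ℕ) : ℝ) := by
          exact_mod_cast Nat.mul_le_mul hcard hcard
      _ = 25 ^ n := by rw [← mul_pow]; norm_num

section QuadraticForm

variable {n : ℕ} {W : Fin n → Fin n → ℝ} {σ t s : ℝ}

/-- The Laplacian-type form `∑ᵢ (∑ⱼ Mᵢⱼ) xᵢ² - ∑ᵢⱼ Mᵢⱼ xᵢ xⱼ` of a symmetric `M`. -/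
lemma laplacian_form_eq {M : Fin n → Fin n → ℝ} (hM : ∀ i j, M i j = M j i) (x : Fin n → ℝ) :
    ∑ i, (∑ j, M i j) * x i ^ 2 - ∑ i, ∑ j, M i j * (x i * x j) =
      (∑ i, ∑ j, M i j * (x i - x j) ^ 2) / 2 := by
  have h1 : ∑ i, ∑ j, M i j * x j ^ 2 = ∑ i, ∑ j, M i j * x i ^ 2 := by
    rw [Finset.sum_comm]
    exact Finset.sum_congr rfl fun i _ => Finset.sum_congr rfl fun j _ => by rw [hM]
  have h2 : ∀ i j, M i j * (x i - x j) ^ 2 =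
      M i j * x i ^ 2 + M i j * x j ^ 2 - 2 * (M i j * (x i * x j)) := by intros; ring
  simp_rw [h2, Finset.sum_sub_distrib, Finset.sum_add_distrib, h1, Finset.sum_mul,
    ← Finset.mul_sum]
  ring

lemma quadratic_form_lt (hW : ∀ i j, W i j = W j i) (hσ : 0 < σ) (hgap : σ * (t + s) < n)
    (hrow : ∀ i, -t ≤ ∑ j, W i j)
    (hform : ∀ x : Fin n → ℝ, ∑ i, ∑ j, W i j * (x i * x j) ≤ s * ∑ i, x i ^ 2)
    {x : Fin n → ℝ} (hx : ∃ i j, x i ≠ x j) :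
    ∑ i, ∑ j, (1 + σ * W i j) * (x i * x j) < ∑ i, (∑ j, (1 + σ * W i j)) * x i ^ 2 := by
  have hM : ∀ i j, 1 + σ * W i j = 1 + σ * W j i := fun i j => by rw [hW]
  obtain ⟨i₀, j₀, hne⟩ := hx
  have hn : (n : ℝ) ≠ 0 := by exact_mod_cast (Fin.pos i₀).ne'
  let m : ℝ := (∑ i, x i) / n
  let z : Fin n → ℝ := fun i => x i - m
  have hz0 : ∑ i, z i = 0 := by
    simp only [z, m, Finset.sum_sub_distrib, Finset.sum_const, Finset.card_univ, Fintype.card_fin,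
      nsmul_eq_mul]
    field_simp
    ring
  have hzpos : 0 < ∑ i, z i ^ 2 := by
    refine (Finset.sum_nonneg fun i _ => sq_nonneg _).lt_of_ne fun h => hne ?_
    have h0 := (Finset.sum_eq_zero_iff_of_nonneg fun i _ => sq_nonneg (z i)).1 h.symm
    have hi := pow_eq_zero_iff (two_ne_zero) |>.1 (h0 i₀ (Finset.mem_univ _))
    have hj := pow_eq_zero_iff (two_ne_zero) |>.1 (h0 j₀ (Finset.mem_univ _))
    simp only [z] at hi hj
    linarith
  have hshift := laplacian_form_eq hM x
  have hshift' := laplacian_form_eq hM z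
  have hzx : ∀ i j, z i - z j = x i - x j := fun i j => by simp only [z]; ring
  simp_rw [hzx] at hshift'
  have h1 : ∑ i, ∑ j, (1 + σ * W i j) * (z i * z j) = σ * ∑ i, ∑ j, W i j * (z i * z j) := by
    simp_rw [add_mul, one_mul, Finset.sum_add_distrib, ← Finset.sum_mul_sum, hz0, mul_assoc,
      ← Finset.mul_sum]
    ring
  have h2 : (n - σ * t) * ∑ i, z i ^ 2 ≤ ∑ i, (∑ j, (1 + σ * W i j)) * z i ^ 2 := by
    rw [Finset.mul_sum]
    refine Finset.sum_le_sum fun i _ => mul_le_mul_of_nonneg_right ?_ (sq_nonneg _)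
    rw [Finset.sum_add_distrib, ← Finset.mul_sum]
    have := mul_le_mul_of_nonneg_left (hrow i) hσ.le
    simp only [Finset.sum_const, Finset.card_univ, Fintype.card_fin, nsmul_eq_mul]
    linarith
  have h3 := mul_le_mul_of_nonneg_left (hform z) hσ.le
  have h4 : 0 < (n - σ * (t + s)) * ∑ i, z i ^ 2 := mul_pos (by linarith) hzpos
  nlinarith

lemma quadratic_form_le (hW : ∀ i j, W i j = W j i) (hσ : 0 < σ) (hgap : σ * (t + s) < n)
    (hrow : ∀ i, -t ≤ ∑ j, W i j)
    (hform : ∀ x : Fin n → ℝ, ∑ i, ∑ j, W i j * (x i * x j) ≤ s * ∑ i, x i ^ 2)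
    (x : Fin n → ℝ) :
    ∑ i, ∑ j, (1 + σ * W i j) * (x i * x j) ≤ ∑ i, (∑ j, (1 + σ * W i j)) * x i ^ 2 := by
  by_cases hx : ∃ i j, x i ≠ x j
  · exact (quadratic_form_lt hW hσ hgap hrow hform hx).le
  · push Not at hx
    refine le_of_eq (Finset.sum_congr rfl fun i _ => ?_)
    rw [Finset.sum_mul]
    exact Finset.sum_congr rfl fun j _ => by rw [hx j i, sq]

end QuadraticForm

open scoped MatrixOrder Matrix.Norms.L2Operator in
lemma exists_eq_conjTranspose_mul_self {m : Type*} [Fintype m] [DecidableEq m]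
    {X : Matrix m m ℂ} (hX : X.PosSemidef) : ∃ B : Matrix m m ℂ, X = B.conjTranspose * B :=
  CStarAlgebra.nonneg_iff_eq_star_mul_self.mp hX.nonneg

/-- Deterministic part: the planted matrix is the unique maximizer of the semidefinite program as
soon as the row sums and the quadratic form of the noise are controlled. -/
lemma sdp_unique_of_bounds {n : ℕ} {σ t s : ℝ} (hσ : 0 < σ) (hgap : σ * (t + s) < n)
    {yv : Fin n → ℂ} (hy : ∀ i, yv i * (starRingEnd ℂ) (yv i) = 1) {A : Fin n → Fin n → ℝ}
    (hrow : ∀ i, -t ≤ ∑ j, symOfParam A i j)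
    (hform : ∀ x : Fin n → ℝ, ∑ i, ∑ j, symOfParam A i j * (x i * x j) ≤ s * ∑ i, x i ^ 2)
    (X : Matrix (Fin n) (Fin n) ℂ) (hX : X.PosSemidef) (hdiag : ∀ i, X i i = 1)
    (hne : X ≠ Matrix.of fun i j => yv i * (starRingEnd ℂ) (yv j)) :
    (∑ i, ∑ j, sdpObs σ yv A i j * (starRingEnd ℂ) (X i j)).re <
      (∑ i, ∑ j, sdpObs σ yv A i j *
        (starRingEnd ℂ) (yv i * (starRingEnd ℂ) (yv j))).re := by
  obtain ⟨B, hB⟩ := exists_eq_conjTranspose_mul_self hX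
  have hXB : ∀ i j, X i j = ∑ k, (starRingEnd ℂ) (B k i) * B k j := by
    intro i j
    rw [hB]
    simp [Matrix.mul_apply]
  let M : Fin n → Fin n → ℝ := fun i j => 1 + σ * symOfParam A i j
  let z : Fin n → Fin n → ℂ := fun k i => yv i * B k i
  have hobs : ∀ i j, sdpObs σ yv A i j = (M i j : ℂ) * (yv i * (starRingEnd ℂ) (yv j)) := by
    intro i j
    simp only [sdpObs, M]
    push_cast
    ring
  have hzB : ∀ k i j, z k i * (starRingEnd ℂ) (z k j) =
      yv i * (starRingEnd ℂ) (yv j) * (B k i * (starRingEnd ℂ) (B k j)) := by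
    intro k i j
    simp only [z, map_mul]
    ring
  have hnorm : ∀ i, ∑ k, ((z k i).re ^ 2 + (z k i).im ^ 2) = 1 := by
    intro i
    have h : ∑ k, z k i * (starRingEnd ℂ) (z k i) = 1 := by
      simp_rw [hzB, hy, one_mul]
      rw [← hdiag i, hXB]
      exact Finset.sum_congr rfl fun k _ => mul_comm _ _
    have := congrArg Complex.re h
    simp only [Complex.re_sum, Complex.mul_re, Complex.conj_re, Complex.conj_im,
      Complex.one_re] at this
    rw [← this]
    exact Finset.sum_congr rfl fun k _ => by ring
  have hleft : (∑ i, ∑ j, sdpObs σ yv A i j * (starRingEnd ℂ) (X i j)).re =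
      ∑ k, (∑ i, ∑ j, M i j * ((z k i).re * (z k j).re) +
        ∑ i, ∑ j, M i j * ((z k i).im * (z k j).im)) := by
    have h : ∀ i j, (sdpObs σ yv A i j * (starRingEnd ℂ) (X i j)).re =
        ∑ k, (M i j * ((z k i).re * (z k j).re) + M i j * ((z k i).im * (z k j).im)) := by
      intro i j
      have h' : sdpObs σ yv A i j * (starRingEnd ℂ) (X i j) =
          ∑ k, (M i j : ℂ) * (z k i * (starRingEnd ℂ) (z k j)) := by
        rw [hobs, hXB]
        simp_rw [hzB, map_sum, map_mul, Complex.conj_conj, Finset.mul_sum]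
        exact Finset.sum_congr rfl fun k _ => by ring
      rw [h', Complex.re_sum]
      refine Finset.sum_congr rfl fun k _ => ?_
      rw [Complex.re_ofReal_mul]
      simp only [Complex.mul_re, Complex.conj_re, Complex.conj_im]
      ring
    simp_rw [Complex.re_sum, h, ← Finset.sum_add_distrib]
    exact Finset.sum_comm_cycle
  have hright : (∑ i, ∑ j, sdpObs σ yv A i j *
        (starRingEnd ℂ) (yv i * (starRingEnd ℂ) (yv j))).re =
      ∑ k, (∑ i, (∑ j, M i j) * (z k i).re ^ 2 + ∑ i, (∑ j, M i j) * (z k i).im ^ 2) := by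
    have h : ∀ i j, (sdpObs σ yv A i j *
        (starRingEnd ℂ) (yv i * (starRingEnd ℂ) (yv j))).re = M i j := by
      intro i j
      have h' : sdpObs σ yv A i j * (starRingEnd ℂ) (yv i * (starRingEnd ℂ) (yv j)) = M i j := by
        rw [hobs, map_mul, Complex.conj_conj]
        linear_combination (M i j : ℂ) * (yv j * (starRingEnd ℂ) (yv j)) * hy i + (M i j : ℂ) * hy j
      rw [h', Complex.ofReal_re]
    simp_rw [Complex.re_sum, h, ← Finset.sum_add_distrib, ← mul_add]
    conv_rhs => rw [Finset.sum_comm]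
    simp_rw [← Finset.mul_sum, hnorm, mul_one]
  have hle := quadratic_form_le (symOfParam_comm A) hσ hgap hrow hform
  have hlt := fun x : Fin n → ℝ =>
    quadratic_form_lt (x := x) (symOfParam_comm A) hσ hgap hrow hform
  rw [hleft, hright]
  by_cases hconst : ∀ k i j, z k i = z k j
  · refine absurd ?_ hne
    ext i j
    rw [Matrix.of_apply]
    have h : ∑ k, z k i * (starRingEnd ℂ) (z k j) = 1 := by
      simp_rw [fun k => hconst k i j, hzB, hy, one_mul]
      rw [← hdiag j, hXB]
      exact Finset.sum_congr rfl fun k _ => mul_comm _ _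
    have h' : yv i * (starRingEnd ℂ) (yv j) * (starRingEnd ℂ) (X i j) = 1 := by
      rw [← h, hXB, map_sum, Finset.mul_sum]
      exact Finset.sum_congr rfl fun k _ => by rw [hzB, map_mul, Complex.conj_conj]
    have h'' := congrArg (starRingEnd ℂ) h'
    simp only [map_mul, Complex.conj_conj, map_one] at h''
    linear_combination yv i * (starRingEnd ℂ) (yv j) * h'' -
      X i j * (yv j * (starRingEnd ℂ) (yv j)) * hy i - X i j * hy j
  · push Not at hconst
    obtain ⟨k, i, j, hkij⟩ := hconst
    refine Finset.sum_lt_sum (fun k _ => add_le_add (hle _) (hle _)) ⟨k, Finset.mem_univ _, ?_⟩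
    by_cases hre : (z k i).re = (z k j).re
    · refine add_lt_add_of_le_of_lt (hle _) (hlt _ ⟨i, j, fun him => hkij ?_⟩)
      exact Complex.ext hre him
    · exact add_lt_add_of_lt_of_le (hlt _ ⟨i, j, hre⟩) (hle _)

/-- The bound on the probability of failure vanishes as `n → ∞`. -/
lemma tendsto_failure_bound {σ : ℕ → ℝ} (hσpos : ∀ n, 0 < σ n) {δ : ℝ} (hδ : 0 < δ) (hδ1 : δ < 1)
    (hσ : ∀ n : ℕ, 2 ≤ n → σ n < (1 - δ) * Real.sqrt n / Real.sqrt (2 * Real.log n)) :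
    Tendsto (fun n : ℕ =>
      ENNReal.ofReal (n * Real.exp (-(((1 - δ / 2) * n / σ n) ^ 2 / (2 * n)))) +
        ENNReal.ofReal (25 ^ n * Real.exp (-((δ / 4 * n / σ n) ^ 2 / 128)))) atTop (nhds 0) := by
  have hδ' : 0 < 1 - δ := by linarith
  have hlog : Tendsto (fun n : ℕ => Real.log n) atTop atTop :=
    Real.tendsto_log_atTop.comp tendsto_natCast_atTop_atTop
  have hkey : ∀ n : ℕ, 2 ≤ n →
      2 * Real.log n * n / (1 - δ) ^ 2 ≤ (n / σ n) ^ 2 := by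
    intro n hn
    have hn0 : (0 : ℝ) < n := by positivity
    have hL : 0 < Real.log n := Real.log_pos (by exact_mod_cast hn)
    have h1 := hσ n hn
    rw [lt_div_iff₀ (by positivity)] at h1
    have h2 : (σ n * Real.sqrt (2 * Real.log n)) ^ 2 ≤ ((1 - δ) * Real.sqrt n) ^ 2 :=
      pow_le_pow_left₀ (mul_nonneg (hσpos n).le (Real.sqrt_nonneg _)) h1.le 2
    rw [mul_pow, mul_pow, Real.sq_sqrt (by positivity), Real.sq_sqrt hn0.le] at h2
    have hσn := hσpos n
    rw [div_pow, div_le_div_iff₀ (by positivity) (by positivity)]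
    nlinarith
  rw [← add_zero (0 : ENNReal), ← ENNReal.ofReal_zero]
  refine Tendsto.add (ENNReal.tendsto_ofReal ?_) (ENNReal.tendsto_ofReal ?_)
  · let r : ℝ := ((1 - δ / 2) / (1 - δ)) ^ 2
    have hr : 1 < r := one_lt_pow₀ ((one_lt_div hδ').2 (by linarith)) two_ne_zero
    have hlim : Tendsto (fun n : ℕ => Real.exp (-((r - 1) * Real.log n))) atTop (nhds 0) :=
      Real.tendsto_exp_neg_atTop_nhds_zero.comp (hlog.const_mul_atTop (by linarith))
    refine squeeze_zero' (Eventually.of_forall fun n => by positivity) ?_ hlim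
    filter_upwards [eventually_ge_atTop 2] with n hn
    have hn0 : (0 : ℝ) < n := by positivity
    nth_rewrite 1 [← Real.exp_log hn0]
    rw [← Real.exp_add, Real.exp_le_exp]
    have h1 : (1 - δ / 2) ^ 2 / (2 * n) * (2 * Real.log n * n / (1 - δ) ^ 2) ≤
        (1 - δ / 2) ^ 2 / (2 * n) * (n / σ n) ^ 2 :=
      mul_le_mul_of_nonneg_left (hkey n hn) (by positivity)
    have h2 : (1 - δ / 2) ^ 2 / (2 * n) * (2 * Real.log n * n / (1 - δ) ^ 2) =
        r * Real.log n := by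
      simp only [r]
      field_simp
    have h3 : (1 - δ / 2) ^ 2 / (2 * n) * (n / σ n) ^ 2 =
        ((1 - δ / 2) * n / σ n) ^ 2 / (2 * n) := by ring
    linarith
  · have hlim : Tendsto (fun n : ℕ => Real.exp (-(n : ℝ))) atTop (nhds 0) :=
      Real.tendsto_exp_neg_atTop_nhds_zero.comp tendsto_natCast_atTop_atTop
    refine squeeze_zero' (Eventually.of_forall fun n => by positivity) ?_ hlim
    filter_upwards [eventually_ge_atTop 2, (hlog.const_mul_atTop
      (show (0 : ℝ) < δ ^ 2 / 1024 by positivity)).eventually_ge_atTop (Real.log 25 + 1)]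
      with n hn hbig
    have hn0 : (0 : ℝ) < n := by positivity
    have hL : 0 < Real.log n := Real.log_pos (by exact_mod_cast hn)
    rw [← Real.exp_log (show (0 : ℝ) < 25 by norm_num), ← Real.exp_nat_mul, ← Real.exp_add,
      Real.exp_le_exp]
    have h1 : 2 * Real.log n * n ≤ (n / σ n) ^ 2 := by
      refine le_trans ?_ (hkey n hn)
      exact le_div_self (by positivity) (by positivity) (pow_le_one₀ hδ'.le (by linarith))
    have h2 := mul_le_mul_of_nonneg_left h1 (show 0 ≤ δ ^ 2 / 2048 by positivity)
    have h3 : (δ / 4 * n / σ n) ^ 2 / 128 = δ ^ 2 / 2048 * (n / σ n) ^ 2 := by ring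
    have h4 := mul_le_mul_of_nonneg_left hbig hn0.le
    rw [h3]
    linarith

theorem sdp_exact_recovery
    (k : ℕ → ℕ) (hk : ∀ n : ℕ, 2 ≤ k n)
    (d : (n : ℕ) → Fin (k n) → ℝ)
    (hd : ∀ n : ℕ, Function.Injective (d n))
    (hdrange : ∀ n : ℕ, ∀ i : Fin (k n), d n i ∈ Set.Ico (0 : ℝ) (2 * Real.pi))
    (y : (n : ℕ) → Fin n → Fin (k n))
    (σ : ℕ → ℝ) (hσpos : ∀ n : ℕ, 0 < σ n)
    (δ : ℝ) (hδ : 0 < δ)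
    (hσ : ∀ n : ℕ, 2 ≤ n →
      σ n < (1 - δ) * Real.sqrt n / Real.sqrt (2 * Real.log n)) :
    Tendsto (fun n : ℕ => gaussMatrix n
      {A | ∀ X : Matrix (Fin n) (Fin n) ℂ, X.PosSemidef → (∀ i, X i i = 1) →
        X ≠ Matrix.of (fun i j => Complex.exp (Complex.I * (d n (y n i) : ℂ)) *
            (starRingEnd ℂ) (Complex.exp (Complex.I * (d n (y n j) : ℂ)))) →
        (∑ i, ∑ j,
            sdpObs (σ n) (fun v => Complex.exp (Complex.I * (d n (y n v) : ℂ))) A i j *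
              (starRingEnd ℂ) (X i j)).re <
        (∑ i, ∑ j,
            sdpObs (σ n) (fun v => Complex.exp (Complex.I * (d n (y n v) : ℂ))) A i j *
              (starRingEnd ℂ) (Complex.exp (Complex.I * (d n (y n i) : ℂ)) *
                (starRingEnd ℂ) (Complex.exp (Complex.I * (d n (y n j) : ℂ))))).re})
      atTop (nhds 1) := by
  have hδ1 : δ < 1 := by
    by_contra! h
    have h1 := (hσpos 2).trans (hσ 2 le_rfl)
    refine h1.not_ge (div_nonpos_of_nonpos_of_nonneg ?_ (Real.sqrt_nonneg _))
    exact mul_nonpos_of_nonpos_of_nonneg (by linarith) (Real.sqrt_nonneg _)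
  have hlim := ENNReal.Tendsto.sub tendsto_const_nhds (tendsto_failure_bound hσpos hδ hδ1 hσ)
    (Or.inl ENNReal.one_ne_top)
  rw [tsub_zero] at hlim
  have hprob : ∀ n, IsProbabilityMeasure (gaussMatrix n) := fun n => by
    unfold gaussMatrix; infer_instance
  refine tendsto_of_tendsto_of_tendsto_of_le_of_le' hlim tendsto_const_nhds ?_
    (Eventually.of_forall fun n => prob_le_one)
  filter_upwards [eventually_ge_atTop 1] with n hn
  have hn0 : (0 : ℝ) < n := by positivity
  have hσn := hσpos n
  have ht : 0 ≤ (1 - δ / 2) * n / σ n :=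
    div_nonneg (mul_nonneg (by linarith) hn0.le) hσn.le
  have hs : 0 ≤ δ / 4 * n / σ n := by positivity
  have hgap : σ n * ((1 - δ / 2) * n / σ n + δ / 4 * n / σ n) < n := by
    have : σ n * ((1 - δ / 2) * n / σ n + δ / 4 * n / σ n) = n - δ / 4 * n := by
      field_simp
      ring
    rw [this]
    nlinarith [mul_pos hδ hn0]
  have hy : ∀ i, Complex.exp (Complex.I * (d n (y n i) : ℂ)) *
      (starRingEnd ℂ) (Complex.exp (Complex.I * (d n (y n i) : ℂ))) = 1 := by
    intro i
    rw [← Complex.exp_conj, ← Complex.exp_add]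
    simp
  refine (tsub_le_tsub_left (gaussMatrix_bad_le n ht hs) 1).trans ?_
  rw [tsub_le_iff_right, ← measure_univ (μ := gaussMatrix n)]
  refine (measure_mono fun A _ => ?_).trans (measure_union_le _ _)
  by_cases hA : (∀ i, -((1 - δ / 2) * n / σ n) ≤ ∑ j, symOfParam A i j) ∧
      ∀ x : Fin n → ℝ, ∑ i, ∑ j, symOfParam A i j * (x i * x j) ≤
        δ / 4 * n / σ n * ∑ i, x i ^ 2
  · exact Or.inl fun X hX hdiag hne =>
      sdp_unique_of_bounds hσn hgap hy hA.1 hA.2 X hX hdiag hne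
  · exact Or.inr hA
end

section
/- Let n, k ≥ 2, distinct reals c_1,…,c_k, positive integers n_1 ≥ … ≥ n_k summing to n, and the true color assignment y ∈ Ω_{n_1,…,n_k} be given, with observation T = G(y) + σW and C_0 = min_{1≤i<j≤k}(c_i−c_j)². Suppose δ ∈ (0,1/2) and B_0 > 0 satisfy log k − δ·log n/(1−δ) ≤ −B_0 < 0, and suppose σ² < (1−δ)·C_0·n/(4 log n). Then the probability that y is the unique minimizer of ‖T − G(x)‖_F² over x ∈ Ω_{n_1,…,n_k} is at least 2 − exp( e^{−2B_0} / ((1−e^{−B_0})(1−e^{−2B_0})) ). -/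
open MeasureTheory ProbabilityTheory Filter Finset

/-- The squared Frobenius norm of a real `n × n` matrix. -/
noncomputable def frobSq {n : ℕ} (A : Fin n → Fin n → ℝ) : ℝ := ∑ i, ∑ j, A i j ^ 2

/-- The matrix `G(x)` with entries `G(x)_{ij} = c_{x(i)} - c_{x(j)}`. -/
noncomputable def Gmat {n k : ℕ} (c : Fin k → ℝ) (x : Fin n → Fin k) : Fin n → Fin n → ℝ :=
  fun i j => c (x i) - c (x j)

/-- The number of maps at Hamming distance `m` from `y` is at most `(n k) ^ m`. -/
lemma card_hammingDist_eq_le {n k : ℕ} (y : Fin n → Fin k) (m : ℕ) :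
    (univ.filter fun x : Fin n → Fin k => hammingDist x y = m).card ≤ (n * k) ^ m := by
  let graphOff (x : Fin n → Fin k) : Finset (Fin n × Fin k) :=
    (univ.filter fun v => x v ≠ y v).image fun v => (v, x v)
  have mem_graphOff (x : Fin n → Fin k) (v : Fin n) (a : Fin k) :
      (v, a) ∈ graphOff x ↔ x v ≠ y v ∧ x v = a := by
    simp [graphOff]
  calc _ ≤ (powersetCard m (univ : Finset (Fin n × Fin k))).card := by
        refine card_le_card_of_injOn graphOff ?_ ?_
        · intro x hx
          have hx' : hammingDist x y = m := by simpa using hx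
          rw [mem_coe, mem_powersetCard_univ]
          rw [← hx', card_image_of_injective _ fun v w h => congrArg Prod.fst h]
          rfl
        · intro x _ x' _ h
          funext v
          have key (a : Fin k) := (mem_graphOff x v a).symm.trans
            ((h ▸ Iff.rfl : _ ↔ (v, a) ∈ graphOff x').trans (mem_graphOff x' v a))
          by_contra hne
          by_cases hx : x v = y v
          · have := (key (x' v)).2 ⟨fun e => hne (hx.trans e.symm), rfl⟩
            exact this.1 hx
          · exact hne ((key (x v)).1 ⟨hx, rfl⟩).2.symm
    _ = (n * k).choose m := by simp
    _ ≤ (n * k) ^ m := Nat.choose_le_pow _ _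

lemma sum_pow_hammingDist_le {n k : ℕ} (y : Fin n → Fin k) (F : Finset (Fin n → Fin k))
    (hF : ∀ x ∈ F, 2 ≤ hammingDist x y) {ρ q : ℝ} (hρ : 0 ≤ ρ) (hq : n * k * ρ ≤ q)
    (hq1 : q < 1) :
    ∑ x ∈ F, ρ ^ hammingDist x y ≤ q ^ 2 / (1 - q) := by
  classical
  have hnk : 0 ≤ n * k * ρ := by positivity
  have hq0 : 0 ≤ q := hnk.trans hq
  calc ∑ x ∈ F, ρ ^ hammingDist x y
      = ∑ m ∈ Ico 2 (n + 2), ∑ x ∈ F with hammingDist x y = m, ρ ^ hammingDist x y := by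
        refine (sum_fiberwise_of_maps_to (fun x hx => ?_) _).symm
        have : hammingDist x y ≤ n := by simpa using hammingDist_le_card_fintype (x := x) (y := y)
        have := hF x hx
        simp only [mem_Ico]
        lia
    _ ≤ ∑ m ∈ Ico 2 (n + 2), q ^ m := by
        refine sum_le_sum fun m _ => ?_
        calc ∑ x ∈ F with hammingDist x y = m, ρ ^ hammingDist x y
            = (F.filter fun x => hammingDist x y = m).card * ρ ^ m := by
              rw [sum_congr rfl fun x hx => by rw [(mem_filter.1 hx).2], sum_const, nsmul_eq_mul]
          _ ≤ ((n * k : ℕ) : ℝ) ^ m * ρ ^ m := by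
              gcongr
              exact_mod_cast (card_le_card (filter_subset_filter _ (subset_univ F))).trans
                (card_hammingDist_eq_le y m)
          _ = (n * k * ρ) ^ m := by push_cast; ring
          _ ≤ q ^ m := by gcongr
    _ ≤ q ^ 2 / (1 - q) := geom_sum_Ico_le_of_lt_one hq0 hq1

instance (n : ℕ) : IsProbabilityMeasure (gaussMatrix n) := by
  unfold gaussMatrix; infer_instance

/-- Chernoff bound for a linear form in the entries of a Gaussian matrix. -/
lemma gaussMatrix_le_sum_le {n : ℕ} (b : Fin n → Fin n → ℝ) (s : ℝ) {t : ℝ} (ht : 0 ≤ t) :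
    (gaussMatrix n).real {W | s ≤ ∑ i, ∑ j, b i j * W i j} ≤
      Real.exp (-t * s + t ^ 2 * frobSq b / 2) := by
  have exp_eq : (fun W : Fin n → Fin n → ℝ => Real.exp (t * ∑ i, ∑ j, b i j * W i j)) =
      fun W => ∏ i, ∏ j, Real.exp (t * b i j * W i j) := by
    funext W
    simp only [← Real.exp_sum, mul_sum, mul_assoc]
  have hint : Integrable (fun W : Fin n → Fin n → ℝ =>
      Real.exp (t * ∑ i, ∑ j, b i j * W i j)) (gaussMatrix n) := by
    rw [exp_eq]
    exact Integrable.fintype_prod fun i => Integrable.fintype_prod fun j =>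
      integrable_exp_mul_gaussianReal _
  have hmgf : mgf (fun W : Fin n → Fin n → ℝ => ∑ i, ∑ j, b i j * W i j) (gaussMatrix n) t =
      Real.exp (t ^ 2 * frobSq b / 2) := by
    have entry (u : ℝ) : ∫ w, Real.exp (u * w) ∂gaussianReal 0 1 = Real.exp (u ^ 2 / 2) := by
      have := congrFun (mgf_id_gaussianReal (μ := 0) (v := 1)) u
      simpa [mgf] using this
    have row (i : Fin n) :
        ∫ w : Fin n → ℝ, ∏ j, Real.exp (t * b i j * w j) ∂Measure.pi (fun _ => gaussianReal 0 1) =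
          Real.exp (∑ j, (t * b i j) ^ 2 / 2) := by
      rw [integral_fintype_prod_eq_prod (fun j (w : ℝ) => Real.exp (t * b i j * w))]
      simp only [entry, ← Real.exp_sum]
    rw [mgf, exp_eq, gaussMatrix,
      integral_fintype_prod_eq_prod (fun i (w : Fin n → ℝ) => ∏ j, Real.exp (t * b i j * w j))]
    rw [prod_congr rfl fun i _ => row i, ← Real.exp_sum]
    congr 1
    simp only [frobSq, mul_sum, sum_div, mul_pow]
  calc _ ≤ Real.exp (-t * s) * mgf (fun W : Fin n → Fin n → ℝ => ∑ i, ∑ j, b i j * W i j)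
        (gaussMatrix n) t := measure_ge_le_exp_mul_mgf s ht hint
    _ = _ := by rw [hmgf, Real.exp_add]

lemma sum_color_eq {n k : ℕ} (c : Fin k → ℝ) (x : Fin n → Fin k) :
    ∑ v, c (x v) = ∑ i, colorCard x i * c i := by
  rw [← sum_fiberwise (s := univ) (g := x)]
  refine sum_congr rfl fun i _ => ?_
  rw [sum_congr rfl fun v hv => by rw [(mem_filter.1 hv).2], sum_const, nsmul_eq_mul, colorCard]

/-- For color assignments with equal total, the distance of the matrices `G` is governed by the
distance of the color vectors. -/
lemma frobSq_Gmat_sub {n k : ℕ} (c : Fin k → ℝ) (x y : Fin n → Fin k)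
    (h : ∑ v, (c (y v) - c (x v)) = 0) :
    frobSq (fun i j => Gmat c y i j - Gmat c x i j) = 2 * n * ∑ v, (c (y v) - c (x v)) ^ 2 := by
  set d : Fin n → ℝ := fun v => c (y v) - c (x v)
  have expand (i j : Fin n) : (Gmat c y i j - Gmat c x i j) ^ 2 =
      d i ^ 2 + d j ^ 2 - 2 * (d i * d j) := by
    simp only [Gmat, d]; ring
  have hd : ∑ v, d v = 0 := h
  change _ = 2 * n * ∑ v, d v ^ 2
  simp only [frobSq, expand, sum_sub_distrib, sum_add_distrib, ← mul_sum, hd, mul_zero, sum_const,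
    card_univ, Fintype.card_fin, nsmul_eq_mul]
  ring

lemma two_le_hammingDist {n k : ℕ} {c : Fin k → ℝ} (hc : Function.Injective c)
    {x y : Fin n → Fin k} (h : ∑ v, (c (y v) - c (x v)) = 0) (hxy : x ≠ y) :
    2 ≤ hammingDist x y := by
  by_contra! hlt
  have hpos : 0 < hammingDist x y := hammingDist_pos.2 hxy
  have h1 : (univ.filter fun v => x v ≠ y v).card = 1 := by
    change hammingDist x y = 1
    lia
  obtain ⟨w, hw⟩ := card_eq_one.1 h1
  have hmem (v : Fin n) : x v ≠ y v ↔ v = w := by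
    simpa using Finset.ext_iff.1 hw v
  rw [sum_eq_single w (fun v _ hv => by
    rw [not_not.1 (mt (hmem v).1 hv), sub_self]) (by simp)] at h
  exact (hmem w).2 rfl (hc (sub_eq_zero.1 h)).symm

lemma mul_hammingDist_le_sum_sq {n k : ℕ} {c : Fin k → ℝ} {C0 : ℝ}
    (hC : ∀ i j, i ≠ j → C0 ≤ (c i - c j) ^ 2) (x y : Fin n → Fin k) :
    C0 * hammingDist x y ≤ ∑ v, (c (y v) - c (x v)) ^ 2 := by
  calc C0 * hammingDist x y = ∑ v ∈ univ.filter (fun v => x v ≠ y v), C0 := by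
        rw [sum_const, nsmul_eq_mul, mul_comm]; rfl
    _ ≤ ∑ v ∈ univ.filter (fun v => x v ≠ y v), (c (y v) - c (x v)) ^ 2 :=
        sum_le_sum fun v hv => hC _ _ (mem_filter.1 hv).2.symm
    _ ≤ _ := sum_le_sum_of_subset_of_nonneg (filter_subset _ _) fun _ _ _ => sq_nonneg _

/-- The probability that `x` beats `y` decays exponentially in the distance of `G(x)` and `G(y)`. -/
lemma gaussMatrix_frobSq_le_le {n k : ℕ} (c : Fin k → ℝ) (x y : Fin n → Fin k) {σ S : ℝ}
    (hS : 0 < S) (hσ : σ ^ 2 ≤ S) :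
    (gaussMatrix n).real {W | frobSq (fun i j => (Gmat c y i j + σ * W i j) - Gmat c x i j) ≤
        frobSq (fun i j => (Gmat c y i j + σ * W i j) - Gmat c y i j)} ≤
      Real.exp (-(frobSq (fun i j => Gmat c y i j - Gmat c x i j) / (8 * S))) := by
  set a : Fin n → Fin n → ℝ := fun i j => Gmat c y i j - Gmat c x i j with ha
  have hset : {W : Fin n → Fin n → ℝ |
      frobSq (fun i j => (Gmat c y i j + σ * W i j) - Gmat c x i j) ≤
        frobSq (fun i j => (Gmat c y i j + σ * W i j) - Gmat c y i j)} =
      {W | frobSq a ≤ ∑ i, ∑ j, (-2 * σ * a i j) * W i j} := by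
    ext W
    simp only [Set.mem_ofPred_eq]
    have : frobSq (fun i j => (Gmat c y i j + σ * W i j) - Gmat c x i j) =
        frobSq (fun i j => (Gmat c y i j + σ * W i j) - Gmat c y i j) + frobSq a -
          ∑ i, ∑ j, (-2 * σ * a i j) * W i j := by
      simp only [frobSq, ← sum_add_distrib, ← sum_sub_distrib]
      refine sum_congr rfl fun i _ => sum_congr rfl fun j _ => ?_
      simp only [ha]; ring
    rw [this]
    constructor <;> intro h <;> linarith
  have hb : frobSq (fun i j => -2 * σ * a i j) = 4 * σ ^ 2 * frobSq a := by
    simp only [frobSq, mul_sum]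
    refine sum_congr rfl fun i _ => sum_congr rfl fun j _ => ?_
    ring
  have hD : 0 ≤ frobSq a := sum_nonneg fun i _ => sum_nonneg fun j _ => sq_nonneg _
  rw [hset]
  refine (gaussMatrix_le_sum_le _ _ (t := 1 / (4 * S)) (by positivity)).trans
    (Real.exp_le_exp.2 ?_)
  rw [hb]
  calc -(1 / (4 * S)) * frobSq a + (1 / (4 * S)) ^ 2 * (4 * σ ^ 2 * frobSq a) / 2
      ≤ -(1 / (4 * S)) * frobSq a + (1 / (4 * S)) ^ 2 * (4 * S * frobSq a) / 2 := by gcongr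
    _ = -(frobSq a / (8 * S)) := by field_simp; ring

lemma min_sq_sub_spec {k : ℕ} (hk : 2 ≤ k) {c : Fin k → ℝ} (hc : Function.Injective c) {C0 : ℝ}
    (hC0 : C0 = sInf {r : ℝ | ∃ i j : Fin k, i < j ∧ r = (c i - c j) ^ 2}) :
    0 < C0 ∧ ∀ i j, i ≠ j → C0 ≤ (c i - c j) ^ 2 := by
  set R := {r : ℝ | ∃ i j : Fin k, i < j ∧ r = (c i - c j) ^ 2} with hR
  have hfin : R.Finite := by
    refine (Set.finite_range fun p : Fin k × Fin k => (c p.1 - c p.2) ^ 2).subset ?_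
    rintro r ⟨i, j, -, rfl⟩
    exact ⟨(i, j), rfl⟩
  have hne : R.Nonempty := ⟨_, ⟨0, by lia⟩, ⟨1, by lia⟩, by simp, rfl⟩
  have hle (i j : Fin k) (h : i < j) : C0 ≤ (c i - c j) ^ 2 :=
    hC0 ▸ csInf_le hfin.bddBelow ⟨i, j, h, rfl⟩
  constructor
  · obtain ⟨i, j, hij, h⟩ := hne.csInf_mem hfin
    rw [hC0, h]
    exact sq_pos_of_ne_zero (sub_ne_zero.2 (hc.ne hij.ne))
  · intro i j h
    rcases h.lt_or_gt with h | h
    · exact hle i j h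
    · exact sub_sq_comm (c i) (c j) ▸ hle j i h

theorem exact_recovery_G_quantitative
    (n k : ℕ) (hk : 2 ≤ k) (c : Fin k → ℝ) (hc : Function.Injective c)
    (C0 : ℝ)
    (hC0 : C0 = sInf {r : ℝ | ∃ i j : Fin k, i < j ∧ r = (c i - c j) ^ 2})
    (nn : Fin k → ℕ)
    (hmono : ∀ i j : Fin k, i ≤ j → nn j ≤ nn i)
    (hpos : ∀ i : Fin k, 0 < nn i)
    (hsum : ∑ i, nn i = n)
    (y : Fin n → Fin k)
    (hy : ∀ i : Fin k, colorCard y i = nn i)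
    (σ : ℝ) (δ B₀ : ℝ) (hδ : 0 < δ ∧ δ < 1 / 2) (hB₀ : 0 < B₀)
    (hkn : Real.log k - δ * Real.log n / (1 - δ) ≤ -B₀)
    (hσ : σ ^ 2 < (1 - δ) * C0 * n / (4 * Real.log n)) :
    ENNReal.ofReal
        (2 - Real.exp (Real.exp (-2 * B₀) /
          ((1 - Real.exp (-B₀)) * (1 - Real.exp (-2 * B₀))))) ≤
      gaussMatrix n
        {W | ∀ x : Fin n → Fin k, (∀ i, colorCard x i = nn i) → x ≠ y →
          frobSq (fun i j => (Gmat c y i j + σ * W i j) - Gmat c y i j) <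
          frobSq (fun i j => (Gmat c y i j + σ * W i j) - Gmat c x i j)} := by
  classical
  obtain ⟨hC0pos, hC0le⟩ := min_sq_sub_spec hk hc hC0
  have hn : 2 ≤ n := by
    calc 2 ≤ ∑ _i : Fin k, 1 := by simpa using hk
      _ ≤ ∑ i, nn i := sum_le_sum fun i _ => hpos i
      _ = n := hsum
  have hn0 : (0 : ℝ) < n := by positivity
  have hk0 : (0 : ℝ) < k := by positivity
  have hδ1 : 0 < 1 - δ := by linarith [hδ.2]
  have hlog : 0 < Real.log n := Real.log_pos (by exact_mod_cast hn)
  set S : ℝ := (1 - δ) * C0 * n / (4 * Real.log n) with hS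
  have hSpos : 0 < S := by positivity
  set q := Real.exp (-B₀) with hqdef
  have hq0 : 0 < q := Real.exp_pos _
  have hq1 : q < 1 := Real.exp_lt_one_iff.2 (by linarith)
  have hq2 : Real.exp (-2 * B₀) = q ^ 2 := by
    rw [hqdef, ← Real.exp_nat_mul]; congr 1; push_cast; ring
  set ρ := Real.exp (-(Real.log n / (1 - δ))) with hρdef
  have hρ : n * k * ρ ≤ q := by
    calc n * k * ρ = Real.exp (Real.log k - δ * Real.log n / (1 - δ)) := by
          rw [hρdef]
          nth_rewrite 1 [← Real.exp_log hn0]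
          nth_rewrite 1 [← Real.exp_log hk0]
          rw [← Real.exp_add, ← Real.exp_add]
          congr 1
          field_simp
          ring
      _ ≤ q := Real.exp_le_exp.2 hkn
  set good : Set (Fin n → Fin n → ℝ) := {W | ∀ x : Fin n → Fin k, (∀ i, colorCard x i = nn i) →
    x ≠ y → frobSq (fun i j => (Gmat c y i j + σ * W i j) - Gmat c y i j) <
      frobSq (fun i j => (Gmat c y i j + σ * W i j) - Gmat c x i j)}
  let F : Finset (Fin n → Fin k) := univ.filter fun x => (∀ i, colorCard x i = nn i) ∧ x ≠ y
  let bad (x : Fin n → Fin k) : Set (Fin n → Fin n → ℝ) :=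
    {W | frobSq (fun i j => (Gmat c y i j + σ * W i j) - Gmat c x i j) ≤
      frobSq (fun i j => (Gmat c y i j + σ * W i j) - Gmat c y i j)}
  have hsumF (x) (hx : x ∈ F) : ∑ v, (c (y v) - c (x v)) = 0 := by
    rw [sum_sub_distrib, sum_color_eq, sum_color_eq]
    simp [hy, (mem_filter.1 hx).2.1]
  have hbad (x) (hx : x ∈ F) : (gaussMatrix n).real (bad x) ≤ ρ ^ hammingDist x y := by
    refine (gaussMatrix_frobSq_le_le c x y hSpos hσ.le).trans ?_
    rw [hρdef, ← Real.exp_nat_mul, frobSq_Gmat_sub c x y (hsumF x hx)]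
    refine Real.exp_le_exp.2 ?_
    rw [mul_neg, neg_le_neg_iff]
    calc hammingDist x y * (Real.log n / (1 - δ))
        = 2 * n * (C0 * hammingDist x y) / (8 * S) := by rw [hS]; field_simp; ring
      _ ≤ 2 * n * (∑ v, (c (y v) - c (x v)) ^ 2) / (8 * S) := by
          gcongr
          exact mul_hammingDist_le_sum_sq hC0le x y
  have hcover : (Set.univ : Set (Fin n → Fin n → ℝ)) ⊆ good ∪ ⋃ x ∈ F, bad x := by
    intro W _
    by_cases hW : W ∈ good
    · exact Or.inl hW
    · simp only [good, Set.mem_ofPred_eq, not_forall, not_lt] at hW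
      obtain ⟨x, hx, hxy, hle⟩ := hW
      exact Or.inr (Set.mem_biUnion (mem_filter.2 ⟨mem_univ x, hx, hxy⟩ : x ∈ F) hle)
  have hone : 1 ≤ (gaussMatrix n).real good + q ^ 2 / (1 - q) := by
    calc 1 = (gaussMatrix n).real Set.univ := by simp
      _ ≤ (gaussMatrix n).real good + (gaussMatrix n).real (⋃ x ∈ F, bad x) :=
          (measureReal_mono hcover).trans (measureReal_union_le _ _)
      _ ≤ (gaussMatrix n).real good + ∑ x ∈ F, ρ ^ hammingDist x y := by
          gcongr
          exact (measureReal_biUnion_finset_le _ _).trans (sum_le_sum hbad)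
      _ ≤ _ := by
          gcongr
          exact sum_pow_hammingDist_le y F
            (fun x hx => two_le_hammingDist hc (hsumF x hx) (mem_filter.1 hx).2.2)
            (Real.exp_pos _).le hρ hq1
  have hweaken : q ^ 2 / (1 - q) ≤ q ^ 2 / ((1 - q) * (1 - q ^ 2)) := by
    have h1 : 0 < 1 - q := by linarith
    have h2 : 0 < 1 - q ^ 2 := by nlinarith
    gcongr
    nlinarith [sq_nonneg q]
  rw [hq2, ← ofReal_measureReal]
  refine ENNReal.ofReal_le_ofReal ?_
  linarith [Real.add_one_le_exp (q ^ 2 / ((1 - q) * (1 - q ^ 2)))]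
end

section
/- For each n, let k(n) ≥ 2, distinct reals c_1,…,c_{k(n)}, a real c(n) ∈ (0,1], and the true color assignment y_n ∈ Ω be given, with observation R_n = K(y_n) + σ_n W_n; write n_1(y_n) ≥ … ≥ n_{k(n)}(y_n) for the sizes |y_n^{-1}(c_i)| in decreasing order. Assume: (i) |y_n^{-1}(c_i)| ≥ c(n)·n for every i and every n; (ii) lim_{n→∞} log k(n) / (c(n)³ · log n) = 0; (iii) there is a constant δ > 0 (independent of n) with σ_n² < (1−δ)·(n_k(y_n)+n_{k−1}(y_n))/(4 log n) for all n. Then the probability that every minimizer of ‖R_n − K(x)‖_F² over x ∈ Ω_{2c(n)/3} is equivalent to y_n tends to 1 as n → ∞. -/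
open MeasureTheory ProbabilityTheory Filter Finset

/-- The matrix `K(x)` with `K(x)_{ij} = 1` if `x(i) ≠ x(j)` and `0` otherwise. -/
noncomputable def Kmat {n k : ℕ} (x : Fin n → Fin k) : Fin n → Fin n → ℝ :=
  fun i j => if x i = x j then 0 else 1

/-- Two color assignments are equivalent if they induce the same partition of the vertices. -/
def ColorEquiv {n k : ℕ} (x z : Fin n → Fin k) : Prop :=
  ∀ i j : Fin n, x i = x j ↔ z i = z j

/-- The matrix `K(y) - K(z)`. -/
noncomputable def Kdiff {n k : ℕ} (y z : Fin n → Fin k) : Fin n → Fin n → ℝ :=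
  fun i j => Kmat y i j - Kmat z i j

lemma sum_ite_eq_colorCard {n k : ℕ} (y : Fin n → Fin k) (a : Fin k) :
    ∑ v, (if y v = a then (1 : ℝ) else 0) = colorCard y a := by
  simp [colorCard]

lemma Kdiff_sq_comm {n k : ℕ} (y z : Fin n → Fin k) (u v : Fin n) :
    Kdiff y z u v ^ 2 = Kdiff y z v u ^ 2 := by
  simp only [Kdiff, Kmat, eq_comm]

lemma Kmat_congr {n k : ℕ} {x z : Fin n → Fin k} (h : ColorEquiv x z) : Kmat x = Kmat z := by
  funext i j
  simp only [Kmat, h i j]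

/-- Each misclassified vertex disagrees with every correctly classified vertex of its old and of
its new color. -/
lemma le_frobSq_Kdiff_of_hammingDist {n k : ℕ} (y z : Fin n → Fin k) (m : ℝ)
    (hm : ∀ a b, a ≠ b → m ≤ (colorCard y a : ℝ) + colorCard y b) :
    2 * (hammingDist z y : ℝ) * (m - hammingDist z y) ≤ frobSq (Kdiff y z) := by
  set B : Finset (Fin n) := univ.filter fun v => z v ≠ y v with hB
  have hh : hammingDist z y = #B := rfl
  have row : ∀ u ∈ B, m - #B ≤ ∑ v ∈ Bᶜ, Kdiff y z u v ^ 2 := by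
    intro u hu
    have hu' : z u ≠ y u := by simpa [hB] using hu
    have h1 : ∑ v ∈ Bᶜ, Kdiff y z u v ^ 2 =
        ∑ v ∈ Bᶜ, ((if y v = y u then (1 : ℝ) else 0) + if y v = z u then 1 else 0) := by
      refine Finset.sum_congr rfl fun v hv => ?_
      have hv' : z v = y v := by simpa [hB] using hv
      simp only [Kdiff, Kmat, hv']
      by_cases h1 : y v = y u
      · have h2 : y v ≠ z u := fun h => hu' (h.symm.trans h1)
        simp [h1, hu', hu'.symm]
      · by_cases h2 : y v = z u
        · simp [h2, hu', hu'.symm]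
        · simp [h1, h2, Ne.symm h1, Ne.symm h2, eq_comm]
    have h2 : ∑ v ∈ B, ((if y v = y u then (1 : ℝ) else 0) + if y v = z u then 1 else 0)
        ≤ #B := by
      rw [Finset.card_eq_sum_ones, Nat.cast_sum]
      refine Finset.sum_le_sum fun v _ => ?_
      by_cases h1 : y v = y u
      · simp [h1, hu'.symm]
      · by_cases h2 : y v = z u <;> simp [h1, h2]
        simp [hu']
    have h3 := Finset.sum_add_sum_compl B
      fun v => ((if y v = y u then (1 : ℝ) else 0) + if y v = z u then 1 else 0)
    rw [Finset.sum_add_distrib (s := univ), sum_ite_eq_colorCard, sum_ite_eq_colorCard] at h3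
    have := hm _ _ hu'.symm
    linarith
  have hrow : (#B : ℝ) * (m - #B) ≤ ∑ u ∈ B, ∑ v ∈ Bᶜ, Kdiff y z u v ^ 2 := by
    rw [← nsmul_eq_mul]
    exact Finset.card_nsmul_le_sum _ _ _ row
  have hcol : ∑ u ∈ Bᶜ, ∑ v ∈ B, Kdiff y z u v ^ 2 = ∑ u ∈ B, ∑ v ∈ Bᶜ, Kdiff y z u v ^ 2 := by
    rw [Finset.sum_comm]
    exact Finset.sum_congr rfl fun v _ => Finset.sum_congr rfl fun u _ => Kdiff_sq_comm y z u v
  have htot : frobSq (Kdiff y z) =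
      ∑ u ∈ B, ∑ v, Kdiff y z u v ^ 2 + ∑ u ∈ Bᶜ, ∑ v, Kdiff y z u v ^ 2 :=
    (Finset.sum_add_sum_compl B _).symm
  have h1 : ∑ u ∈ B, ∑ v ∈ Bᶜ, Kdiff y z u v ^ 2 ≤ ∑ u ∈ B, ∑ v, Kdiff y z u v ^ 2 :=
    Finset.sum_le_sum fun u _ => Finset.sum_le_univ_sum_of_nonneg fun v => sq_nonneg _
  have h2 : ∑ u ∈ Bᶜ, ∑ v ∈ B, Kdiff y z u v ^ 2 ≤ ∑ u ∈ Bᶜ, ∑ v, Kdiff y z u v ^ 2 :=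
    Finset.sum_le_sum fun u _ => Finset.sum_le_univ_sum_of_nonneg fun v => sq_nonneg _
  rw [hh]
  linarith

/-- If `K(z)` is close to `K(y)` in Frobenius norm, then `z` is close to `y` in Hamming distance,
up to a permutation of the colors. -/
lemma exists_perm_hammingDist_le {n k : ℕ} (y z : Fin n → Fin k) {N η : ℝ} (hN : 0 < N)
    (hη : η ≤ 1 / 4) (hy : ∀ a, N ≤ colorCard y a)
    (hD : frobSq (Kdiff y z) < η * N ^ 2) :
    ∃ π : Equiv.Perm (Fin k), (hammingDist (π ∘ z) y : ℝ) ≤ η * N := by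
  let t : Fin k → Fin k → ℝ := fun i j => ∑ v, if y v = i ∧ z v = j then (1 : ℝ) else 0
  have hf : ∀ i, ∃ j, ∀ j', t i j' ≤ t i j := fun i => by
    have : Nonempty (Fin k) := ⟨i⟩
    exact Finite.exists_max (t i)
  choose f hf using hf
  set B : Finset (Fin n) := univ.filter fun v => z v ≠ f (y v) with hB
  have hterm : ∀ u v, (if y v = y u ∧ z v ≠ z u then (1 : ℝ) else 0) ≤ Kdiff y z u v ^ 2 := by
    intro u v
    split_ifs with h
    · simp [Kdiff, Kmat, h.1, Ne.symm h.2]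
    · positivity
  have hterm' : ∀ u v, (if y v ≠ y u ∧ z v = z u then (1 : ℝ) else 0) ≤ Kdiff y z u v ^ 2 := by
    intro u v
    split_ifs with h
    · simp [Kdiff, Kmat, h.2, Ne.symm h.1]
    · positivity
  have hsplit : ∀ i j, t i j + ∑ v, (if y v = i ∧ z v ≠ j then (1 : ℝ) else 0) = colorCard y i := by
    intro i j
    rw [← sum_ite_eq_colorCard, ← Finset.sum_add_distrib]
    refine Finset.sum_congr rfl fun v _ => ?_
    by_cases h1 : y v = i <;> by_cases h2 : z v = j <;> simp [h1, h2]
  have hB1 : N * #B ≤ frobSq (Kdiff y z) := by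
    calc N * #B = ∑ v ∈ B, N := by simp [mul_comm]
      _ ≤ ∑ v ∈ B, (colorCard y (y v) : ℝ) := Finset.sum_le_sum fun v _ => hy _
      _ = ∑ v, ∑ u, (if y v = y u ∧ z v ≠ f (y u) then (1 : ℝ) else 0) := by
        rw [hB, Finset.sum_filter]
        refine Finset.sum_congr rfl fun v _ => ?_
        rw [← sum_ite_eq_colorCard]
        split_ifs with h
        · refine Finset.sum_congr rfl fun u _ => ?_
          by_cases h1 : y u = y v
          · simp [h1, h]
          · simp [h1, Ne.symm h1]
        · symm
          refine Finset.sum_eq_zero fun u _ => if_neg ?_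
          rintro ⟨h1, h2⟩
          rw [← h1] at h2
          exact h h2
      _ = ∑ u, ∑ v, (if y v = y u ∧ z v ≠ f (y u) then (1 : ℝ) else 0) := Finset.sum_comm
      _ ≤ ∑ u, ∑ v, (if y v = y u ∧ z v ≠ z u then (1 : ℝ) else 0) := by
        refine Finset.sum_le_sum fun u _ => ?_
        have h1 := hsplit (y u) (f (y u))
        have h2 := hsplit (y u) (z u)
        have h3 := hf (y u) (z u)
        linarith
      _ ≤ frobSq (Kdiff y z) := Finset.sum_le_sum fun u _ => Finset.sum_le_sum fun v _ => hterm u v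
  have hBle : (#B : ℝ) ≤ η * N := by
    have : N * #B < N * (η * N) := by nlinarith
    exact (lt_of_mul_lt_mul_left this hN.le).le
  have hlarge : ∀ i, N / 2 ≤ t i (f i) := by
    intro i
    have h1 := hsplit i (f i)
    have h2 : ∑ v, (if y v = i ∧ z v ≠ f i then (1 : ℝ) else 0) ≤ #B := by
      rw [hB, Finset.card_filter, Nat.cast_sum]
      refine Finset.sum_le_sum fun v _ => ?_
      by_cases h : y v = i
      · subst h; simp
      · simp only [h, false_and, if_false]; positivity
    have h3 := hy i
    nlinarith
  have hinj : Function.Injective f := by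
    intro i i' hii
    by_contra hne
    have h1 : t i (f i) * t i' (f i') ≤ frobSq (Kdiff y z) := by
      simp only [t, Finset.sum_mul_sum]
      refine Finset.sum_le_sum fun u _ => Finset.sum_le_sum fun v _ => le_trans ?_ (hterm' u v)
      by_cases h1 : y u = i ∧ z u = f i
      · by_cases h2 : y v = i' ∧ z v = f i'
        · have : y v ≠ y u ∧ z v = z u :=
            ⟨by rw [h1.1, h2.1]; exact Ne.symm hne, by rw [h1.2, h2.2, hii]⟩
          rw [if_pos h1, if_pos h2, if_pos this, one_mul]
        · rw [if_neg h2, mul_zero]; positivity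
      · rw [if_neg h1, zero_mul]; positivity
    have h2 := mul_le_mul (hlarge i) (hlarge i') (by positivity)
      ((by positivity : 0 ≤ N / 2).trans (hlarge i))
    nlinarith [sq_nonneg N]
  refine ⟨(Equiv.ofBijective f (Finite.injective_iff_bijective.mp hinj)).symm, ?_⟩
  convert hBle using 2
  rw [hammingDist, hB]
  congr 1
  ext v
  simp [Equiv.symm_apply_eq]

lemma integrable_exp_gaussMatrix {n : ℕ} (A : Fin n → Fin n → ℝ) (t : ℝ) :
    Integrable (fun W => Real.exp (t * ∑ i, ∑ j, A i j * W i j)) (gaussMatrix n) := by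
  have h : Integrable (fun W : Fin n → Fin n → ℝ => ∏ i, ∏ j, Real.exp (t * A i j * W i j))
      (gaussMatrix n) :=
    Integrable.fintype_prod (f := fun i (w : Fin n → ℝ) => ∏ j, Real.exp (t * A i j * w j))
      fun i => Integrable.fintype_prod (f := fun j (w : ℝ) => Real.exp (t * A i j * w))
        fun j => integrable_exp_mul_gaussianReal _
  convert h using 2 with W
  simp only [← Real.exp_sum, Finset.mul_sum, mul_assoc]

instance {n : ℕ} : IsProbabilityMeasure (gaussMatrix n) := by
  unfold gaussMatrix; infer_instance

lemma mgf_gaussMatrix {n : ℕ} (A : Fin n → Fin n → ℝ) (t : ℝ) :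
    mgf (fun W => ∑ i, ∑ j, A i j * W i j) (gaussMatrix n) t =
      Real.exp (t ^ 2 * frobSq A / 2) := by
  have h1 : ∀ W : Fin n → Fin n → ℝ, Real.exp (t * ∑ i, ∑ j, A i j * W i j) =
      ∏ i, ∏ j, Real.exp (t * A i j * W i j) := fun W => by
    simp only [← Real.exp_sum, Finset.mul_sum, mul_assoc]
  have h2 : ∀ s : ℝ, ∫ w, Real.exp (s * w) ∂(gaussianReal 0 1) = Real.exp (s ^ 2 / 2) :=
    fun s => by
      have := congrFun (mgf_fun_id_gaussianReal (μ := 0) (v := 1)) s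
      simpa [mgf] using this
  rw [mgf]
  simp only [h1, gaussMatrix]
  rw [integral_fintype_prod_eq_prod
    (f := fun i (w : Fin n → ℝ) => ∏ j, Real.exp (t * A i j * w j))]
  have h3 : ∀ i, ∫ w : Fin n → ℝ, ∏ j, Real.exp (t * A i j * w j)
      ∂(Measure.pi fun _ : Fin n => gaussianReal 0 1) = ∏ j, Real.exp ((t * A i j) ^ 2 / 2) := by
    intro i
    rw [integral_fintype_prod_eq_prod (f := fun j (w : ℝ) => Real.exp (t * A i j * w))]
    simp only [h2]
  simp only [h3]
  simp only [← Real.exp_sum]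
  congr 1
  simp only [frobSq, Finset.mul_sum, Finset.sum_div]
  exact Finset.sum_congr rfl fun i _ => Finset.sum_congr rfl fun j _ => by ring

/-- Chernoff bound for the event that the noise makes `A` at least as good as `0`. -/
lemma gaussMatrix_le_exp {n : ℕ} (A : Fin n → Fin n → ℝ) {σ s : ℝ} (hs : 0 < s)
    (hσ : σ ^ 2 ≤ s) :
    gaussMatrix n {W | frobSq A + 2 * σ * ∑ i, ∑ j, A i j * W i j ≤ 0} ≤
      ENNReal.ofReal (Real.exp (-(frobSq A / (8 * s)))) := by
  have hA : 0 ≤ frobSq A := Finset.sum_nonneg fun i _ => Finset.sum_nonneg fun j _ => sq_nonneg _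
  have h := measure_ge_le_exp_mul_mgf (μ := gaussMatrix n)
    (X := fun W => ∑ i, ∑ j, (-2 * σ * A i j) * W i j) (frobSq A)
    (t := 1 / (4 * s)) (by positivity) (integrable_exp_gaussMatrix _ _)
  rw [mgf_gaussMatrix, ← Real.exp_add] at h
  have hset : {W : Fin n → Fin n → ℝ | frobSq A + 2 * σ * ∑ i, ∑ j, A i j * W i j ≤ 0} =
      {W | frobSq A ≤ ∑ i, ∑ j, (-2 * σ * A i j) * W i j} := by
    ext W
    have : ∑ i, ∑ j, (-2 * σ * A i j) * W i j = -(2 * σ * ∑ i, ∑ j, A i j * W i j) := by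
      simp only [Finset.mul_sum, ← Finset.sum_neg_distrib]
      exact Finset.sum_congr rfl fun i _ => Finset.sum_congr rfl fun j _ => by ring
    simp only [Set.mem_ofPred_eq, this]
    constructor <;> intro h <;> linarith
  have hfrob : frobSq (fun i j => -2 * σ * A i j) = 4 * σ ^ 2 * frobSq A := by
    simp only [frobSq, Finset.mul_sum]
    exact Finset.sum_congr rfl fun i _ => Finset.sum_congr rfl fun j _ => by ring
  rw [hset, ← ofReal_measureReal]
  refine ENNReal.ofReal_le_ofReal (h.trans (Real.exp_le_exp.mpr ?_))
  rw [hfrob]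
  have h1 : σ ^ 2 * frobSq A ≤ s * frobSq A := mul_le_mul_of_nonneg_right hσ hA
  have h2 : (1 / (4 * s)) ^ 2 * (4 * σ ^ 2 * frobSq A) / 2 = σ ^ 2 * frobSq A / (8 * s ^ 2) := by
    field_simp; ring
  have h3 : σ ^ 2 * frobSq A / (8 * s ^ 2) ≤ s * frobSq A / (8 * s ^ 2) := by gcongr
  have h4 : s * frobSq A / (8 * s ^ 2) = frobSq A / (8 * s) := by field_simp
  have h5 : -(1 / (4 * s)) * frobSq A = -(2 * (frobSq A / (8 * s))) := by field_simp; ring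
  linarith

lemma sum_pow_hammingDist {n k : ℕ} (hk : 1 ≤ k) (y : Fin n → Fin k) (q : ℝ) :
    ∑ z, q ^ hammingDist z y = (1 + (k - 1) * q) ^ n := by
  have h1 : ∀ z, q ^ hammingDist z y = ∏ v, if z v = y v then 1 else q := fun z => by
    rw [hammingDist, ← Finset.prod_const, Finset.prod_filter]
    exact Finset.prod_congr rfl fun v _ => by by_cases h : z v = y v <;> simp [h]
  have h2 : ∀ v, ∑ j, (if j = y v then 1 else q) = 1 + (k - 1) * q := fun v => by
    rw [← Finset.add_sum_erase _ _ (Finset.mem_univ (y v)), if_pos rfl,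
      Finset.sum_congr rfl fun j hj => if_neg (Finset.ne_of_mem_erase hj)]
    simp [Finset.card_erase_of_mem, Nat.cast_sub hk]
  simp only [h1]
  rw [← Fintype.prod_sum (f := fun v j => if j = y v then 1 else q)]
  simp [h2]

lemma frobSq_sub_Kmat {n k : ℕ} (y x : Fin n → Fin k) (σ : ℝ) (W : Fin n → Fin n → ℝ) :
    frobSq (fun i j => (Kmat y i j + σ * W i j) - Kmat x i j) =
      frobSq (fun i j => (Kmat y i j + σ * W i j) - Kmat y i j) +
        (frobSq (Kdiff y x) + 2 * σ * ∑ i, ∑ j, Kdiff y x i j * W i j) := by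
  simp only [frobSq, Kdiff, Finset.mul_sum, ← Finset.sum_add_distrib]
  exact Finset.sum_congr rfl fun i _ => Finset.sum_congr rfl fun j _ => by ring

/-- Non-asymptotic bound on the failure probability of exact recovery. -/
lemma gaussMatrix_not_recovered_le {n k : ℕ} (hn : 0 < n) (hk : 1 ≤ k) (y : Fin n → Fin k)
    {σ c δ L m : ℝ} (hδ : 0 < δ) (hδ1 : δ < 1) (hc : 0 < c) (hL : 0 < L)
    (hy : ∀ i, c * n ≤ colorCard y i)
    (hm : ∀ a b, a ≠ b → m ≤ (colorCard y a : ℝ) + colorCard y b)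
    (hm2 : 2 * (c * n) ≤ m) (hmn : m ≤ n) (hσ : σ ^ 2 ≤ (1 - δ) * m / (4 * L)) :
    gaussMatrix n {W | ∀ x : Fin n → Fin k,
          (∀ j : Fin k, 2 * c / 3 * n ≤ (colorCard x j : ℝ)) →
          (∀ z : Fin n → Fin k, (∀ j : Fin k, 2 * c / 3 * n ≤ (colorCard z j : ℝ)) →
            frobSq (fun i j => (Kmat y i j + σ * W i j) - Kmat x i j) ≤
            frobSq (fun i j => (Kmat y i j + σ * W i j) - Kmat z i j)) →
          ColorEquiv x y}ᶜ ≤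
      ENNReal.ofReal (((1 + (k - 1) * Real.exp (-((1 + δ / 2) * L))) ^ n - 1) +
        k ^ n * Real.exp (-(δ / 8 * (c ^ 2 * n * L)))) := by
  have hn' : (0 : ℝ) < n := Nat.cast_pos.mpr hn
  have hN : 0 < c * n := mul_pos hc hn'
  have hm0 : 0 < m := by linarith
  have hδ' : 0 < 1 - δ := by linarith
  set s : ℝ := (1 - δ) * m / (4 * L) with hs
  have hs0 : 0 < s := by positivity
  set q : ℝ := Real.exp (-((1 + δ / 2) * L)) with hq
  set e : ℝ := Real.exp (-(δ / 8 * (c ^ 2 * n * L)))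
  set S : Finset (Fin n → Fin k) := univ.filter fun z =>
    (z ≠ y ∧ (hammingDist z y : ℝ) ≤ δ / 4 * (c * n)) ∨ δ / 4 * (c * n) ^ 2 ≤ frobSq (Kdiff y z)
    with hS
  have hsub : {W : Fin n → Fin n → ℝ | ∀ x : Fin n → Fin k,
          (∀ j : Fin k, 2 * c / 3 * n ≤ (colorCard x j : ℝ)) →
          (∀ z : Fin n → Fin k, (∀ j : Fin k, 2 * c / 3 * n ≤ (colorCard z j : ℝ)) →
            frobSq (fun i j => (Kmat y i j + σ * W i j) - Kmat x i j) ≤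
            frobSq (fun i j => (Kmat y i j + σ * W i j) - Kmat z i j)) →
          ColorEquiv x y}ᶜ ⊆ ⋃ z ∈ S,
            {W | frobSq (Kdiff y z) + 2 * σ * ∑ i, ∑ j, Kdiff y z i j * W i j ≤ 0} := by
    intro W hW
    simp only [Set.mem_compl_iff, Set.mem_ofPred_eq, not_forall] at hW
    obtain ⟨x, -, hmin, hxy⟩ := hW
    have hle := hmin y fun j => by have := hy j; linarith
    rw [frobSq_sub_Kmat y x] at hle
    simp only [Set.mem_iUnion, Set.mem_ofPred_eq, exists_prop]
    by_cases hD : δ / 4 * (c * n) ^ 2 ≤ frobSq (Kdiff y x)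
    · exact ⟨x, by simp [hS, hD], by linarith⟩
    · obtain ⟨π, hπ⟩ := exists_perm_hammingDist_le y x hN (by linarith) hy (not_le.mp hD)
      have hequiv : ColorEquiv (π ∘ x) x := fun i j => by simp
      refine ⟨π ∘ x, ?_, ?_⟩
      · simp only [hS, Finset.mem_filter, Finset.mem_univ, true_and]
        refine Or.inl ⟨fun h => hxy fun i j => ?_, hπ⟩
        rw [← h]
        exact (hequiv i j).symm
      · have : Kdiff y (π ∘ x) = Kdiff y x := by
          unfold Kdiff
          rw [Kmat_congr hequiv]
        rw [this]
        linarith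
  have hterm : ∀ z ∈ S, Real.exp (-(frobSq (Kdiff y z) / (8 * s))) ≤
      (q ^ hammingDist z y - if z = y then 1 else 0) + e := by
    intro z hz
    have he0 : 0 < e := Real.exp_pos _
    have hq0 : 0 < q := Real.exp_pos _
    simp only [hS, Finset.mem_filter, Finset.mem_univ, true_and] at hz
    have h8 : 8 * s = 2 * (1 - δ) * m / L := by rw [hs]; field_simp; norm_num
    have h8pos : 0 < 8 * s := by positivity
    rcases hz with ⟨hzy, hh⟩ | hD
    · rw [if_neg hzy, sub_zero]
      have h1 := le_frobSq_Kdiff_of_hammingDist y z m hm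
      set h : ℝ := ((hammingDist z y : ℕ) : ℝ)
      have h0 : 0 ≤ h := Nat.cast_nonneg _
      have h2 : 2 * h * (m * (1 - δ / 8)) ≤ 2 * h * (m - h) := by
        apply mul_le_mul_of_nonneg_left _ (by positivity)
        nlinarith
      have h3 : (1 + δ / 2) * (1 - δ) ≤ 1 - δ / 8 := by nlinarith
      have h4 : h * ((1 + δ / 2) * L) ≤ frobSq (Kdiff y z) / (8 * s) := by
        rw [le_div_iff₀ h8pos, h8]
        have h5 : h * ((1 + δ / 2) * L) * (2 * (1 - δ) * m / L) =
            2 * h * (m * ((1 + δ / 2) * (1 - δ))) := by field_simp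
        have h6 : 2 * h * (m * ((1 + δ / 2) * (1 - δ))) ≤ 2 * h * (m * (1 - δ / 8)) := by gcongr
        linarith
      have h7 : Real.exp (-(frobSq (Kdiff y z) / (8 * s))) ≤ q ^ hammingDist z y := by
        rw [hq, ← Real.exp_nat_mul]
        apply Real.exp_le_exp.mpr
        linarith
      linarith
    · have h1 : Real.exp (-(frobSq (Kdiff y z) / (8 * s))) ≤ e := by
        apply Real.exp_le_exp.mpr
        rw [neg_le_neg_iff, le_div_iff₀ h8pos, h8]
        have h5 : δ / 8 * (c ^ 2 * n * L) * (2 * (1 - δ) * m / L) =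
            δ / 4 * (c ^ 2 * n) * ((1 - δ) * m) := by field_simp; ring
        have h6 : (1 - δ) * m ≤ n := by nlinarith
        calc _ = _ := h5
          _ ≤ δ / 4 * (c ^ 2 * n) * n := by gcongr
          _ = δ / 4 * (c * n) ^ 2 := by ring
          _ ≤ _ := hD
      have h2 : 0 ≤ q ^ hammingDist z y - if z = y then 1 else 0 := by
        split_ifs with h
        · simp [h]
        · simp only [sub_zero]; positivity
      linarith
  have hnonneg : ∀ z, 0 ≤ (q ^ hammingDist z y - if z = y then 1 else 0) + e := by
    intro z
    have he0 : 0 < e := Real.exp_pos _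
    have hq0 : 0 < q := Real.exp_pos _
    split_ifs with h
    · simp [h, he0.le]
    · simp only [sub_zero]; positivity
  calc _ ≤ gaussMatrix n (⋃ z ∈ S,
            {W | frobSq (Kdiff y z) + 2 * σ * ∑ i, ∑ j, Kdiff y z i j * W i j ≤ 0}) :=
        measure_mono hsub
    _ ≤ ∑ z ∈ S, gaussMatrix n
            {W | frobSq (Kdiff y z) + 2 * σ * ∑ i, ∑ j, Kdiff y z i j * W i j ≤ 0} :=
        measure_biUnion_finset_le _ _
    _ ≤ ∑ z ∈ S, ENNReal.ofReal ((q ^ hammingDist z y - if z = y then 1 else 0) + e) :=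
        Finset.sum_le_sum fun z hz => (gaussMatrix_le_exp _ hs0 hσ).trans
          (ENNReal.ofReal_le_ofReal (hterm z hz))
    _ ≤ ∑ z, ENNReal.ofReal ((q ^ hammingDist z y - if z = y then 1 else 0) + e) :=
        Finset.sum_le_univ_sum_of_nonneg fun _ => zero_le
    _ = ENNReal.ofReal (∑ z, ((q ^ hammingDist z y - if z = y then 1 else 0) + e)) :=
        (ENNReal.ofReal_sum_of_nonneg fun z _ => hnonneg z).symm
    _ = _ := by
        rw [Finset.sum_add_distrib, Finset.sum_sub_distrib, sum_pow_hammingDist hk]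
        simp

lemma recovery_bound_le {n k : ℕ} (hn : 0 < n) (hk : 2 ≤ k) {c δ L : ℝ} (hδ : 0 < δ)
    (hc : 0 < c) (hc1 : c ≤ 1) (hL : L = Real.log n) (hL0 : 0 < L)
    (hkL : Real.log k ≤ δ / 16 * (c ^ 3 * L)) :
    ((1 + (k - 1) * Real.exp (-((1 + δ / 2) * L))) ^ n - 1) +
        k ^ n * Real.exp (-(δ / 8 * (c ^ 2 * n * L))) ≤
      (Real.exp (Real.exp (-(δ / 4) * L)) - 1) + Real.exp (-Real.log 2 * n) := by
  have hn' : (0 : ℝ) < n := Nat.cast_pos.mpr hn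
  have hk' : (0 : ℝ) < k := by positivity
  have hk2 : (2 : ℝ) ≤ k := by exact_mod_cast hk
  have hc3 : c ^ 3 ≤ c ^ 2 := pow_le_pow_of_le_one hc.le hc1 (by norm_num)
  have hc31 : c ^ 3 ≤ 1 := pow_le_one₀ hc.le hc1
  have hkL1 : Real.log k ≤ δ / 16 * L := hkL.trans (by gcongr; nlinarith)
  have hkL2 : Real.log k ≤ δ / 16 * (c ^ 2 * L) := hkL.trans (by gcongr)
  have h1 : (1 + (k - 1) * Real.exp (-((1 + δ / 2) * L))) ^ n ≤
      Real.exp (Real.exp (-(δ / 4) * L)) := by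
    set q := Real.exp (-((1 + δ / 2) * L)) with hq
    have hq0 : 0 < q := Real.exp_pos _
    have h2 : 1 + (k - 1) * q ≤ Real.exp (k * q) := by
      have := Real.add_one_le_exp (k * q)
      nlinarith
    calc (1 + (k - 1) * q) ^ n ≤ Real.exp (k * q) ^ n :=
          pow_le_pow_left₀ (by nlinarith) h2 n
      _ = Real.exp (n * (k * q)) := (Real.exp_nat_mul _ _).symm
      _ ≤ _ := by
        apply Real.exp_le_exp.mpr
        have h3 : (n : ℝ) * (k * q) = Real.exp (L + (Real.log k + -((1 + δ / 2) * L))) := by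
          rw [Real.exp_add, Real.exp_add, Real.exp_log hk', hL, Real.exp_log hn', hq, hL]
        rw [h3]
        apply Real.exp_le_exp.mpr
        nlinarith
  have h2 : (k : ℝ) ^ n * Real.exp (-(δ / 8 * (c ^ 2 * n * L))) ≤ Real.exp (-Real.log 2 * n) := by
    have h3 : (k : ℝ) ^ n = Real.exp (n * Real.log k) := by
      rw [Real.exp_nat_mul, Real.exp_log hk']
    rw [h3, ← Real.exp_add]
    apply Real.exp_le_exp.mpr
    have h4 : Real.log 2 ≤ Real.log k := Real.log_le_log (by norm_num) hk2
    have h5 : n * Real.log k ≤ n * (δ / 16 * (c ^ 2 * L)) := by gcongr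
    have h6 : n * Real.log 2 ≤ n * Real.log k := by gcongr
    linarith
  linarith

lemma tendsto_recovery_bound {δ : ℝ} (hδ : 0 < δ) :
    Tendsto (fun n : ℕ => (Real.exp (Real.exp (-(δ / 4) * Real.log n)) - 1) +
      Real.exp (-Real.log 2 * n)) atTop (nhds 0) := by
  have h1 : Tendsto (fun n : ℕ => Real.exp (-(δ / 4) * Real.log n)) atTop (nhds 0) :=
    Real.tendsto_exp_atBot.comp ((Real.tendsto_log_atTop.comp
      tendsto_natCast_atTop_atTop).const_mul_atTop_of_neg (by linarith))
  have h2 : Tendsto (fun n : ℕ => Real.exp (-Real.log 2 * n)) atTop (nhds 0) :=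
    Real.tendsto_exp_atBot.comp (tendsto_natCast_atTop_atTop.const_mul_atTop_of_neg
      (neg_lt_zero.mpr (Real.log_pos (by norm_num))))
  have h3 := ((Real.continuous_exp.tendsto 0).comp h1).sub_const 1
  simpa using h3.add h2

lemma colorCard_add_le {n k : ℕ} (y : Fin n → Fin k) {a b : Fin k} (hab : a ≠ b) :
    colorCard y a + colorCard y b ≤ n := by
  rw [colorCard, colorCard, ← Finset.card_union_of_disjoint]
  · exact (Finset.card_le_univ _).trans_eq (Fintype.card_fin n)
  · rw [Finset.disjoint_filter]
    rintro v - rfl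
    exact hab

lemma last_two_le_colorCard_add {n k : ℕ} {y : Fin n → Fin k}
    (hmono : ∀ i j : Fin k, i ≤ j → colorCard y j ≤ colorCard y i) {p q : Fin k}
    (hp : (p : ℕ) = k - 1) (hq : (q : ℕ) = k - 2) (a b : Fin k) (hab : a ≠ b) :
    colorCard y p + colorCard y q ≤ colorCard y a + colorCard y b := by
  have key : ∀ a b : Fin k, a < b →
      colorCard y p + colorCard y q ≤ colorCard y a + colorCard y b := fun a b hlt => by
    have h1 := hmono a q (by rw [Fin.le_def]; omega)
    have h2 := hmono b p (by rw [Fin.le_def]; omega)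
    omega
  rcases lt_or_gt_of_ne hab with h | h
  · exact key a b h
  · rw [add_comm (colorCard y a)]
    exact key b a h

theorem exact_recovery_K_free_sizes_subcritical
    (k : ℕ → ℕ) (hk : ∀ n : ℕ, 2 ≤ k n)
    (c : (n : ℕ) → Fin (k n) → ℝ) (hc : ∀ n : ℕ, Function.Injective (c n))
    (cc : ℕ → ℝ) (hcc : ∀ n : ℕ, 0 < cc n ∧ cc n ≤ 1)
    (y : (n : ℕ) → Fin n → Fin (k n))
    (hmono : ∀ n : ℕ, ∀ i j : Fin (k n), i ≤ j → colorCard (y n) j ≤ colorCard (y n) i)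
    (hfiber : ∀ n : ℕ, k n ≤ n → ∀ i : Fin (k n), cc n * n ≤ (colorCard (y n) i : ℝ))
    (hklog : Tendsto (fun n : ℕ => Real.log (k n) / (cc n ^ 3 * Real.log n)) atTop (nhds 0))
    (σ : ℕ → ℝ) (δ : ℝ) (hδ : 0 < δ)
    (hσ : ∀ n : ℕ, k n ≤ n →
      σ n ^ 2 < (1 - δ) *
          ((colorCard (y n) ⟨k n - 1, by have := hk n; omega⟩ : ℝ) +
            (colorCard (y n) ⟨k n - 2, by have := hk n; omega⟩ : ℝ)) /
        (4 * Real.log n)) :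
    Tendsto (fun n : ℕ => gaussMatrix n
        {W | ∀ x : Fin n → Fin (k n),
          (∀ j : Fin (k n), 2 * cc n / 3 * n ≤ (colorCard x j : ℝ)) →
          (∀ z : Fin n → Fin (k n), (∀ j : Fin (k n), 2 * cc n / 3 * n ≤ (colorCard z j : ℝ)) →
            frobSq (fun i j => (Kmat (y n) i j + σ n * W i j) - Kmat x i j) ≤
            frobSq (fun i j => (Kmat (y n) i j + σ n * W i j) - Kmat z i j)) →
          ColorEquiv x (y n)})
      atTop (nhds 1) := by
  have hgood : ∀ᶠ n : ℕ in atTop, 2 ≤ n ∧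
      Real.log (k n) ≤ min δ 1 / 16 * (cc n ^ 3 * Real.log n) := by
    filter_upwards [eventually_ge_atTop 2,
      hklog.eventually_le_const (show (0 : ℝ) < min δ 1 / 16 by positivity)] with n hn h
    have hL : 0 < Real.log n := Real.log_pos (by exact_mod_cast hn)
    have := (hcc n).1
    exact ⟨hn, (div_le_iff₀ (by positivity)).mp h⟩
  refine tendsto_of_tendsto_of_tendsto_of_le_of_le'
    (g := fun n : ℕ => 1 - ENNReal.ofReal ((Real.exp (Real.exp (-(δ / 4) * Real.log n)) - 1) +
      Real.exp (-Real.log 2 * n))) (h := fun _ => 1) ?_ tendsto_const_nhds ?_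
    (Eventually.of_forall fun n => prob_le_one)
  · have h := ENNReal.tendsto_ofReal (tendsto_recovery_bound hδ)
    rw [ENNReal.ofReal_zero] at h
    simpa using ENNReal.Tendsto.sub (tendsto_const_nhds (x := (1 : ENNReal))) h (by simp)
  · filter_upwards [hgood] with n ⟨hn, hlog⟩
    have hL : 0 < Real.log n := Real.log_pos (by exact_mod_cast hn)
    have hn0 : 0 < n := by omega
    have hk2 := hk n
    obtain ⟨hc0, hc1⟩ := hcc n
    have hc3 : cc n ^ 3 * Real.log n ≤ Real.log n :=
      mul_le_of_le_one_left hL.le (pow_le_one₀ hc0.le hc1)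
    have hkn : k n ≤ n := by
      have h1 : min δ 1 ≤ 1 := min_le_right _ _
      have h2 : Real.log (k n) ≤ Real.log n := by
        have : 0 < cc n ^ 3 * Real.log n := by positivity
        nlinarith
      exact_mod_cast (Real.log_le_log_iff (by positivity) (by positivity)).mp h2
    have hσn := hσ n hkn
    have hyn := hfiber n hkn
    set p : Fin (k n) := ⟨k n - 1, by omega⟩
    set q : Fin (k n) := ⟨k n - 2, by omega⟩
    have hpq : p ≠ q := by
      intro h
      have := congrArg Fin.val h
      simp only [p, q] at this
      omega
    set m : ℝ := (colorCard (y n) p : ℝ) + colorCard (y n) q with hm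
    have hm2 : 2 * (cc n * n) ≤ m := by linarith [hyn p, hyn q]
    have hm0 : 0 < m := lt_of_lt_of_le (by positivity) hm2
    have hδ1 : δ < 1 := by
      by_contra! h
      have h1 : (1 - δ) * m / (4 * Real.log n) ≤ 0 :=
        div_nonpos_of_nonpos_of_nonneg
          (mul_nonpos_of_nonpos_of_nonneg (by linarith) hm0.le) (by positivity)
      linarith [sq_nonneg (σ n)]
    rw [min_eq_left hδ1.le] at hlog
    have hbound := (gaussMatrix_not_recovered_le hn0 (by omega) (y n) hδ hδ1 hc0 hL hyn
      (fun a b hab => by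
        rw [hm]
        exact_mod_cast last_two_le_colorCard_add (hmono n) (p := p) (q := q) rfl rfl a b hab)
      hm2 (by rw [hm]; exact_mod_cast colorCard_add_le (y n) hpq) hσn.le).trans
      (ENNReal.ofReal_le_ofReal (recovery_bound_le hn0 hk2 hδ hc0 hc1 rfl hL hlog))
    rw [tsub_le_iff_right]
    calc (1 : ENNReal) = gaussMatrix n Set.univ := measure_univ.symm
      _ ≤ _ := measure_univ_le_add_compl _
      _ ≤ _ := by gcongr
end
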